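/- arXiv:1508.00713 — 3 statements merged into one kernel-verified Lean document; each statement's English description precedes it below -/
import Mathlib

section
/- If λ > cT(1+T), then for every X in H and t in [0,T] the functional J_{X,t} attains its infimum over L²(t,T;H), and the minimizer is unique; that is, the control problem V(X,t) = inf_{v(.)} J_{X,t}(v(.)) has one and only one optimal control. -/
open MeasureTheory Set
open scoped RealInnerProductSpace

variable {H : Type*} [NormedAddCommGroup H] [InnerProductSpace ℝ H] [CompleteSpace H]

/-- The state `X(s) = X + ∫_t^s v(σ) dσ` associated to the control `v`. -/
noncomputable def state (X : H) (t : ℝ) (v : ℝ → H) (s : ℝ) : H :=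
  X + ∫ σ in t..s, v σ

/-- A control belongs to `L²(t,T;H)`. -/
def Admissible (t T : ℝ) (v : ℝ → H) : Prop :=
  IntervalIntegrable v volume t T ∧ IntervalIntegrable (fun s => ‖v s‖ ^ 2) volume t T

/-- The cost functional `J_{X,t}(v)`. -/
noncomputable def cost (F FT : H → ℝ) (lam : ℝ) (X : H) (t T : ℝ) (v : ℝ → H) : ℝ :=
  lam / 2 * (∫ s in t..T, ‖v s‖ ^ 2) + (∫ s in t..T, F (state X t v s)) + FT (state X t v T)

/-- The value function `V(X,t) = inf_v J_{X,t}(v)`. -/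
noncomputable def valueFn (F FT : H → ℝ) (lam T : ℝ) (X : H) (t : ℝ) : ℝ :=
  sInf ((fun v => cost F FT lam X t T v) '' {v : ℝ → H | Admissible t T v})

/-- The adjoint state `Z(s) = D F_T(Y(T)) + ∫_s^T D F(Y(σ)) dσ` associated to a path `Y`. -/
noncomputable def adjZ (DF DFT : H → H) (T : ℝ) (Y : ℝ → H) (s : ℝ) : H :=
  DFT (Y T) + ∫ σ in s..T, DF (Y σ)

/-- `Y` solves the two-point boundary value problem
`dY/ds = -(1/λ) Z(s)`, `-dZ/ds = D F(Y(s))`, `Y(t) = X`, `Z(T) = D F_T(Y(T))`,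
where `Z = adjZ DF DFT T Y` encodes the two last conditions. -/
def IsOptimalPath (DF DFT : H → H) (lam T : ℝ) (X : H) (t : ℝ) (Y : ℝ → H) : Prop :=
  ContinuousOn Y (Icc t T) ∧ Y t = X ∧
    ∀ s ∈ Icc t T, HasDerivWithinAt Y (-(1 / lam) • adjZ DF DFT T Y s) (Icc t T) s

lemma quadratic_lower_bound {F : H → ℝ} {DF : H → H} {c : ℝ}
    (hF : ∀ X, HasGradientAt F (DF X) X)
    (hDF : ∀ X₁ X₂ : H, ‖DF X₁ - DF X₂‖ ≤ c * ‖X₁ - X₂‖) (x h : H) :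
    F x + ⟪DF x, h⟫ - c / 2 * ‖h‖ ^ 2 ≤ F (x + h) := by
  have hd : ∀ r : ℝ, HasDerivAt
      (fun r : ℝ => F (x + r • h) - r * ⟪DF x, h⟫ + c / 2 * r ^ 2 * ‖h‖ ^ 2)
      (⟪DF (x + r • h), h⟫ - ⟪DF x, h⟫ + c * r * ‖h‖ ^ 2) r := by
    intro r
    have h1 : HasDerivAt (fun r : ℝ => x + r • h) h r := by
      simpa using ((hasDerivAt_id r).smul_const h).const_add x
    have h2 := (hF (x + r • h)).hasFDerivAt.comp_hasDerivAt r h1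
    have h3 := ((hasDerivAt_id r).mul_const ⟪DF x, h⟫)
    have h4 := (((hasDerivAt_id r).pow 2).const_mul (c / 2)).mul_const (‖h‖ ^ 2)
    refine ((h2.sub h3).add h4).congr_deriv ?_
    simp only [InnerProductSpace.toDual_apply_apply, id, Nat.cast_ofNat]
    ring
  have hmono : MonotoneOn
      (fun r : ℝ => F (x + r • h) - r * ⟪DF x, h⟫ + c / 2 * r ^ 2 * ‖h‖ ^ 2) (Icc 0 1) := by
    apply monotoneOn_of_deriv_nonneg (convex_Icc 0 1)
    · exact fun r _ => (hd r).continuousAt.continuousWithinAt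
    · exact fun r _ => (hd r).differentiableAt.differentiableWithinAt
    · intro r hr
      rw [interior_Icc] at hr
      rw [(hd r).deriv, ← inner_sub_left]
      have h1 := abs_le.1 (abs_real_inner_le_norm (DF (x + r • h) - DF x) h)
      have h2 := hDF (x + r • h) x
      rw [add_sub_cancel_left, norm_smul, Real.norm_of_nonneg hr.1.le] at h2
      have h3 := mul_le_mul_of_nonneg_right h2 (norm_nonneg h)
      nlinarith [h1.1]
  have := hmono (left_mem_Icc.2 zero_le_one) (right_mem_Icc.2 zero_le_one) zero_le_one
  simp at this
  linarith

omit [InnerProductSpace ℝ H] [CompleteSpace H] in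
lemma continuous_of_norm_sub_le {G : H → H} {c : ℝ}
    (hG : ∀ X₁ X₂ : H, ‖G X₁ - G X₂‖ ≤ c * ‖X₁ - X₂‖) : Continuous G :=
  (LipschitzWith.of_dist_le' (K := c) fun x y => by simpa [dist_eq_norm] using hG x y).continuous

lemma sq_intervalIntegral_le {f : ℝ → ℝ} {a b : ℝ} (hab : a ≤ b)
    (hf : IntervalIntegrable f volume a b)
    (hf2 : IntervalIntegrable (fun s => f s ^ 2) volume a b) :
    (∫ s in a..b, f s) ^ 2 ≤ (b - a) * ∫ s in a..b, f s ^ 2 := by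
  rcases hab.eq_or_lt with rfl | hlt
  · simp
  set I := ∫ s in a..b, f s with hI
  have h0 : 0 ≤ ∫ s in a..b, ((b - a) * f s - I) ^ 2 :=
    intervalIntegral.integral_nonneg hab fun s _ => sq_nonneg _
  have h1 : ∫ s in a..b, ((b - a) * f s - I) ^ 2
      = (b - a) ^ 2 * (∫ s in a..b, f s ^ 2) - 2 * (b - a) * I * I + (b - a) * I ^ 2 := by
    have : (fun s => ((b - a) * f s - I) ^ 2)
        = fun s => (b - a) ^ 2 * f s ^ 2 - 2 * (b - a) * I * f s + I ^ 2 := by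
      ext s; ring
    rw [this, intervalIntegral.integral_add ((hf2.const_mul _).sub (hf.const_mul _)) (by simp),
      intervalIntegral.integral_sub (hf2.const_mul _) (hf.const_mul _),
      intervalIntegral.integral_const_mul, intervalIntegral.integral_const_mul]
    simp [hI]
  have h2 : 0 < b - a := sub_pos.2 hlt
  have h3 : 0 ≤ (b - a) * ((b - a) * (∫ s in a..b, f s ^ 2) - I ^ 2) := by
    rw [h1] at h0; nlinarith
  have := nonneg_of_mul_nonneg_right h3 h2
  linarith

omit [InnerProductSpace ℝ H] [CompleteSpace H] in
lemma Admissible.mono {t T s : ℝ} {w : ℝ → H} (hw : Admissible t T w) (hs : s ∈ Icc t T) :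
    Admissible t s w := by
  have h : uIcc t s ⊆ uIcc t T := uIcc_subset_uIcc_left (Icc_subset_uIcc hs)
  exact ⟨hw.1.mono_set h, hw.2.mono_set h⟩

omit [CompleteSpace H] in
lemma Admissible.norm_integral_sq_le {t T s : ℝ} {w : ℝ → H} (hw : Admissible t T w)
    (hs : s ∈ Icc t T) :
    ‖∫ σ in t..s, w σ‖ ^ 2 ≤ (T - t) * ∫ σ in t..T, ‖w σ‖ ^ 2 := by
  have hws := hw.mono hs
  calc ‖∫ σ in t..s, w σ‖ ^ 2 ≤ (∫ σ in t..s, ‖w σ‖) ^ 2 := by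
        gcongr
        exact intervalIntegral.norm_integral_le_integral_norm hs.1
    _ ≤ (s - t) * ∫ σ in t..s, ‖w σ‖ ^ 2 := sq_intervalIntegral_le hs.1 hws.1.norm hws.2
    _ ≤ (T - t) * ∫ σ in t..T, ‖w σ‖ ^ 2 := by
        apply mul_le_mul
        · linarith [hs.2]
        · exact intervalIntegral.integral_mono_interval le_rfl hs.1 hs.2
            (Filter.Eventually.of_forall fun _ => sq_nonneg _) hw.2
        · exact intervalIntegral.integral_nonneg hs.1 fun _ _ => sq_nonneg _
        · linarith [hs.1, hs.2]

omit [CompleteSpace H] in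
lemma continuousOn_integral_of_admissible {t T : ℝ} (htT : t ≤ T) {w : ℝ → H}
    (hw : Admissible t T w) : ContinuousOn (fun s => ∫ σ in t..s, w σ) (Icc t T) := by
  have := intervalIntegral.continuousOn_primitive_interval' hw.1 left_mem_uIcc
  rwa [uIcc_of_le htT] at this

/-- Exchange of the order of integration over the triangle `t ≤ s ≤ σ ≤ T`. -/
lemma integral_inner_tail_eq {t T : ℝ} (htT : t ≤ T) {g w : ℝ → H} (hg : Continuous g)
    (hw : IntervalIntegrable w volume t T) :
    ∫ s in t..T, ⟪∫ σ in s..T, g σ, w s⟫ = ∫ σ in t..T, ⟪g σ, ∫ s in t..σ, w s⟫ := by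
  set μ := volume.restrict (Ioc t T) with hμ
  have hgi : Integrable g μ := (intervalIntegrable_iff_integrableOn_Ioc_of_le htT).1
    (hg.intervalIntegrable t T)
  have hwi : Integrable w μ := (intervalIntegrable_iff_integrableOn_Ioc_of_le htT).1 hw
  set k : ℝ × ℝ → ℝ := {p : ℝ × ℝ | p.1 < p.2}.indicator (fun p => ⟪g p.2, w p.1⟫) with hk
  have hki : Integrable k (μ.prod μ) := by
    apply Integrable.indicator _ (measurableSet_lt measurable_fst measurable_snd)
    refine (hwi.norm.mul_prod hgi.norm).mono' ?_ ?_
    · exact hgi.1.comp_snd.inner hwi.1.comp_fst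
    · refine Filter.Eventually.of_forall fun p => ?_
      rw [mul_comm]
      exact norm_inner_le_norm _ _
  have hswap : ∫ s, ∫ σ, k (s, σ) ∂μ ∂μ = ∫ σ, ∫ s, k (s, σ) ∂μ ∂μ :=
    integral_integral_swap hki
  rw [intervalIntegral.integral_of_le htT, intervalIntegral.integral_of_le htT]
  convert hswap using 1
  · refine setIntegral_congr_fun measurableSet_Ioc fun s hs => ?_
    have h1 : (fun σ => k (s, σ)) = (Ioi s).indicator (fun σ => ⟪g σ, w s⟫) := by
      ext σ; simp [hk, indicator]
    have h2 : Ioi s ∩ Ioc t T = Ioc s T := by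
      ext σ; simp only [mem_inter_iff, mem_Ioi, mem_Ioc]
      exact ⟨fun h => ⟨h.1, h.2.2⟩, fun h => ⟨h.1, hs.1.trans h.1, h.2⟩⟩
    have h3 : Integrable g (volume.restrict (Ioc s T)) :=
      (intervalIntegrable_iff_integrableOn_Ioc_of_le hs.2).1 (hg.intervalIntegrable s T)
    rw [h1, integral_indicator measurableSet_Ioi, hμ, Measure.restrict_restrict measurableSet_Ioi,
      h2, intervalIntegral.integral_of_le hs.2, real_inner_comm, ← integral_inner h3]
    simp only [real_inner_comm]
  · refine setIntegral_congr_ae measurableSet_Ioc (Filter.Eventually.of_forall fun σ hσ => ?_)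
    have h1 : (fun s => k (s, σ)) = (Iio σ).indicator (fun s => ⟪g σ, w s⟫) := by
      ext s; simp [hk, indicator]
    have h2 : Iio σ ∩ Ioc t T = Ioo t σ := by
      ext s; simp only [mem_inter_iff, mem_Iio, mem_Ioc, mem_Ioo]
      exact ⟨fun h => ⟨h.2.1, h.1⟩, fun h => ⟨h.2, h.1, h.2.le.trans hσ.2⟩⟩
    have h3 : Integrable w (volume.restrict (Ioc t σ)) :=
      hwi.mono_measure (Measure.restrict_mono (Ioc_subset_Ioc_right hσ.2) le_rfl)
    rw [h1, integral_indicator measurableSet_Iio, hμ, Measure.restrict_restrict measurableSet_Iio,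
      h2, intervalIntegral.integral_of_le hσ.1.le, ← integral_inner h3, integral_Ioc_eq_integral_Ioo]

omit [CompleteSpace H] in
lemma continuous_adjZ {DF DFT : H → H} {T : ℝ} {Y : ℝ → H} (hDF : Continuous DF)
    (hY : Continuous Y) : Continuous (adjZ DF DFT T Y) := by
  have h : Continuous fun s => ∫ σ in T..s, DF (Y σ) :=
    intervalIntegral.continuous_primitive (fun a b => (hDF.comp hY).intervalIntegrable a b) T
  have : adjZ DF DFT T Y = fun s => DFT (Y T) - ∫ σ in T..s, DF (Y σ) := by
    ext s
    rw [adjZ, intervalIntegral.integral_symm, sub_eq_add_neg]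
  rw [this]
  exact continuous_const.sub h

/-- For `c * τ * (1 + τ) < λ`, with `τ = T - t`, the two-point boundary value problem has a
solution, by the contraction principle in `C([t,T]; H)`. -/
lemma exists_optimality_system {DF DFT : H → H} {c T lam t : ℝ} (hc : 0 ≤ c)
    (hDF : ∀ X₁ X₂ : H, ‖DF X₁ - DF X₂‖ ≤ c * ‖X₁ - X₂‖)
    (hDFT : ∀ X₁ X₂ : H, ‖DFT X₁ - DFT X₂‖ ≤ c * ‖X₁ - X₂‖)
    (hlam : 0 < lam) (htT : t ≤ T) (hlc : c * (T - t) * (1 + (T - t)) < lam) (X : H) :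
    ∃ Y : ℝ → H, Continuous Y ∧
      ∀ s ∈ Icc t T, state X t (fun σ => -(1 / lam) • adjZ DF DFT T Y σ) s = Y s := by
  have hDFc := continuous_of_norm_sub_le hDF
  have hext : ∀ f : C(Icc t T, H), Continuous (IccExtend htT f) := fun f =>
    f.continuous.Icc_extend'
  have hu : ∀ f : C(Icc t T, H),
      Continuous fun σ => -(1 / lam) • adjZ DF DFT T (IccExtend htT f) σ := fun f =>
    (continuous_adjZ hDFc (hext f)).const_smul _
  let Φ : C(Icc t T, H) → C(Icc t T, H) := fun f =>
    ⟨fun s => state X t (fun σ => -(1 / lam) • adjZ DF DFT T (IccExtend htT f) σ) s,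
      (continuous_const.add (intervalIntegral.continuous_primitive
        (fun a b => (hu f).intervalIntegrable a b) t)).comp continuous_subtype_val⟩
  have hτ : 0 ≤ T - t := sub_nonneg.2 htT
  have hlip : ∀ f g, dist (Φ f) (Φ g) ≤ c * (T - t) * (1 + (T - t)) / lam * dist f g := by
    intro f g
    rw [ContinuousMap.dist_le (by positivity)]
    intro s
    have hfg : ∀ σ, ‖IccExtend htT f σ - IccExtend htT g σ‖ ≤ dist f g := fun σ => by
      rw [← dist_eq_norm]; exact ContinuousMap.dist_apply_le_dist _
    have hZ : ∀ σ ∈ Icc t T, ‖adjZ DF DFT T (IccExtend htT f) σ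
        - adjZ DF DFT T (IccExtend htT g) σ‖ ≤ c * (1 + (T - t)) * dist f g := by
      intro σ hσ
      have h1 : ‖DFT (IccExtend htT f T) - DFT (IccExtend htT g T)‖ ≤ c * dist f g :=
        (hDFT _ _).trans (mul_le_mul_of_nonneg_left (hfg T) hc)
      have h2 : ‖∫ r in σ..T, (DF (IccExtend htT f r) - DF (IccExtend htT g r))‖
          ≤ c * dist f g * |T - σ| :=
        intervalIntegral.norm_integral_le_of_norm_le_const fun r _ =>
          (hDF _ _).trans (mul_le_mul_of_nonneg_left (hfg r) hc)
      have hi : ∀ f : C(Icc t T, H),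
          IntervalIntegrable (fun r => DF (IccExtend htT f r)) volume σ T := fun f =>
        (hDFc.comp (hext f)).intervalIntegrable _ _
      rw [intervalIntegral.integral_sub (hi f) (hi g), abs_of_nonneg (sub_nonneg.2 hσ.2)] at h2
      have h3 : c * dist f g * (T - σ) ≤ c * dist f g * (T - t) := by
        gcongr
        exact hσ.1
      rw [adjZ, adjZ, add_sub_add_comm]
      refine (norm_add_le _ _).trans ?_
      linarith
    have h4 : ‖∫ σ in t..(s : ℝ), (-(1 / lam) • adjZ DF DFT T (IccExtend htT f) σ
        - -(1 / lam) • adjZ DF DFT T (IccExtend htT g) σ)‖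
        ≤ 1 / lam * (c * (1 + (T - t)) * dist f g) * |(s : ℝ) - t| := by
      apply intervalIntegral.norm_integral_le_of_norm_le_const
      intro σ hσ
      rw [uIoc_of_le s.2.1] at hσ
      rw [← smul_sub, norm_smul, norm_neg, Real.norm_of_nonneg (by positivity)]
      gcongr
      exact hZ σ ⟨hσ.1.le, hσ.2.trans s.2.2⟩
    rw [intervalIntegral.integral_sub ((hu f).intervalIntegrable _ _)
      ((hu g).intervalIntegrable _ _), abs_of_nonneg (sub_nonneg.2 s.2.1)] at h4
    have h5 : 1 / lam * (c * (1 + (T - t)) * dist f g) * ((s : ℝ) - t)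
        ≤ 1 / lam * (c * (1 + (T - t)) * dist f g) * (T - t) := by
      gcongr
      exact s.2.2
    simp only [Φ, ContinuousMap.coe_mk, state, dist_add_left]
    rw [dist_eq_norm]
    refine (h4.trans h5).trans (le_of_eq ?_)
    ring
  have hcontr : ContractingWith (Real.toNNReal (c * (T - t) * (1 + (T - t)) / lam)) Φ := by
    refine ⟨?_, LipschitzWith.of_dist_le' hlip⟩
    rw [Real.toNNReal_lt_one]
    exact (div_lt_one hlam).2 hlc
  have : Nonempty C(Icc t T, H) := ⟨0⟩
  obtain ⟨f, hf⟩ : ∃ f, Φ f = f := ⟨_, hcontr.fixedPoint_isFixedPt⟩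
  refine ⟨IccExtend htT f, hext f, fun s hs => ?_⟩
  rw [IccExtend_of_mem htT _ hs]
  exact congrArg (fun f : C(Icc t T, H) => f ⟨s, hs⟩) hf

lemma cost_add_le {F FT : H → ℝ} {DF DFT : H → H} {c T lam t : ℝ} (hc : 0 ≤ c)
    (hF : ∀ X, HasGradientAt F (DF X) X) (hFT : ∀ X, HasGradientAt FT (DFT X) X)
    (hDF : ∀ X₁ X₂ : H, ‖DF X₁ - DF X₂‖ ≤ c * ‖X₁ - X₂‖)
    (hDFT : ∀ X₁ X₂ : H, ‖DFT X₁ - DFT X₂‖ ≤ c * ‖X₁ - X₂‖)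
    (hlam : 0 < lam) (htT : t ≤ T) {X : H} {Y u : ℝ → H} (hY : Continuous Y)
    (hu : ∀ s, u s = -(1 / lam) • adjZ DF DFT T Y s)
    (hYu : ∀ s ∈ Icc t T, state X t u s = Y s) {w : ℝ → H} (hw : Admissible t T w) :
    cost F FT lam X t T u + (lam - c * (T - t) * (1 + (T - t))) / 2 * (∫ s in t..T, ‖w s‖ ^ 2)
      ≤ cost F FT lam X t T (u + w) := by
  have hDFc := continuous_of_norm_sub_le hDF
  have hZc : Continuous (adjZ DF DFT T Y) := continuous_adjZ hDFc hY
  have huc : Continuous u := by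
    rw [funext hu]
    exact hZc.const_smul _
  have hFc : Continuous F := continuous_iff_continuousAt.2 fun x => (hF x).continuousAt
  set δ : ℝ → H := fun s => ∫ σ in t..s, w σ with hδ
  set W := ∫ s in t..T, ‖w s‖ ^ 2 with hW
  have hδc : ContinuousOn δ (Icc t T) := continuousOn_integral_of_admissible htT hw
  have hTm : T ∈ Icc t T := right_mem_Icc.2 htT
  have hstate : ∀ s ∈ Icc t T, state X t (u + w) s = Y s + δ s := by
    intro s hs
    rw [← hYu s hs, state, state, add_assoc, ← intervalIntegral.integral_add
      (huc.intervalIntegrable _ _) (hw.mono hs).1]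
    rfl
  have hinner : ∀ f : ℝ → H, Continuous f →
      IntervalIntegrable (fun s => ⟪f s, w s⟫) volume t T := by
    intro f hf
    rw [intervalIntegrable_iff_integrableOn_Ioc_of_le htT]
    have hwi := (intervalIntegrable_iff_integrableOn_Ioc_of_le htT).1 hw.1
    obtain ⟨C, hC⟩ := (isCompact_Icc (a := t) (b := T)).exists_bound_of_continuousOn
      hf.continuousOn
    refine Integrable.mono' (hwi.norm.const_mul C) (hf.aestronglyMeasurable.inner hwi.1) ?_
    refine (ae_restrict_iff' measurableSet_Ioc).2 (Filter.Eventually.of_forall fun s hs => ?_)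
    exact (norm_inner_le_norm _ _).trans
      (mul_le_mul_of_nonneg_right (hC s (Ioc_subset_Icc_self hs)) (norm_nonneg _))
  have hquad : lam / 2 * ∫ s in t..T, ‖(u + w) s‖ ^ 2
      = lam / 2 * (∫ s in t..T, ‖u s‖ ^ 2) + lam * (∫ s in t..T, ⟪u s, w s⟫) + lam / 2 * W := by
    have : (fun s => ‖(u + w) s‖ ^ 2) = fun s => ‖u s‖ ^ 2 + 2 * ⟪u s, w s⟫ + ‖w s‖ ^ 2 := by
      ext s
      exact norm_add_sq_real _ _
    have hu2 : IntervalIntegrable (fun s => ‖u s‖ ^ 2) volume t T :=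
      (huc.norm.pow 2).intervalIntegrable _ _
    rw [this, intervalIntegral.integral_add (hu2.add ((hinner u huc).const_mul 2)) hw.2,
      intervalIntegral.integral_add hu2 ((hinner u huc).const_mul 2), intervalIntegral.integral_const_mul]
    ring
  have hcross : lam * (∫ s in t..T, ⟪u s, w s⟫)
      = -⟪DFT (Y T), δ T⟫ - ∫ s in t..T, ⟪DF (Y s), δ s⟫ := by
    have hgc : Continuous fun s => DF (Y s) := hDFc.comp hY
    have htail : Continuous fun s => ∫ σ in s..T, DF (Y σ) := by
      have : (fun s => ∫ σ in s..T, DF (Y σ)) = fun s => adjZ DF DFT T Y s - DFT (Y T) := by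
        ext s; simp [adjZ]
      rw [this]
      exact hZc.sub continuous_const
    have h1 : (fun s => lam * ⟪u s, w s⟫)
        = fun s => -⟪DFT (Y T), w s⟫ - ⟪∫ σ in s..T, DF (Y σ), w s⟫ := by
      ext s
      rw [hu, real_inner_smul_left, adjZ, inner_add_left]
      field_simp
      ring
    have h2 : ∫ s in t..T, ⟪DFT (Y T), w s⟫ = ⟪DFT (Y T), δ T⟫ := by
      rw [hδ]
      simp only [intervalIntegral.integral_of_le htT]
      exact integral_inner ((intervalIntegrable_iff_integrableOn_Ioc_of_le htT).1 hw.1) _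
    have h3 : IntervalIntegrable (fun s => -⟪DFT (Y T), w s⟫) volume t T :=
      (hinner _ continuous_const).neg
    rw [← intervalIntegral.integral_const_mul, h1,
      intervalIntegral.integral_sub h3 (hinner _ htail),
      intervalIntegral.integral_neg, h2, integral_inner_tail_eq htT hgc hw.1]
  have hδle : ∀ s ∈ Icc t T, ‖δ s‖ ^ 2 ≤ (T - t) * W := fun s hs => hw.norm_integral_sq_le hs
  have hii : ∀ f : ℝ → ℝ, ContinuousOn f (Icc t T) → IntervalIntegrable f volume t T :=
    fun f hf => hf.intervalIntegrable_of_Icc htT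
  have hi1 : IntervalIntegrable (fun s => F (Y s)) volume t T :=
    hii _ (hFc.comp hY).continuousOn
  have hi2 : IntervalIntegrable (fun s => ⟪DF (Y s), δ s⟫) volume t T :=
    hii _ ((hDFc.comp hY).continuousOn.inner hδc)
  have hrun : (∫ s in t..T, F (Y s)) + (∫ s in t..T, ⟪DF (Y s), δ s⟫)
      - c / 2 * ((T - t) * W) * (T - t) ≤ ∫ s in t..T, F (state X t (u + w) s) := by
    have h1 : ∫ s in t..T, (F (Y s) + ⟪DF (Y s), δ s⟫ - c / 2 * ((T - t) * W))
        ≤ ∫ s in t..T, F (state X t (u + w) s) := by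
      refine intervalIntegral.integral_mono_on htT ((hi1.add hi2).sub (by simp)) ?_ ?_
      · refine hii _ (ContinuousOn.congr (f := fun s => F (Y s + δ s)) ?_ fun s hs => ?_)
        · exact hFc.comp_continuousOn (hY.continuousOn.add hδc)
        · rw [hstate s hs]
      · intro s hs
        rw [hstate s hs]
        have h2 := quadratic_lower_bound hF hDF (Y s) (δ s)
        have h3 := mul_le_mul_of_nonneg_left (hδle s hs) (div_nonneg hc zero_le_two)
        linarith
    rw [intervalIntegral.integral_sub (hi1.add hi2) (by simp),
      intervalIntegral.integral_add hi1 hi2, intervalIntegral.integral_const, smul_eq_mul] at h1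
    linarith
  have hend : FT (Y T) + ⟪DFT (Y T), δ T⟫ - c / 2 * ((T - t) * W)
      ≤ FT (state X t (u + w) T) := by
    rw [hstate T hTm]
    have h2 := quadratic_lower_bound hFT hDFT (Y T) (δ T)
    have h3 := mul_le_mul_of_nonneg_left (hδle T hTm) (div_nonneg hc zero_le_two)
    linarith
  have hrun_u : ∫ s in t..T, F (state X t u s) = ∫ s in t..T, F (Y s) := by
    refine intervalIntegral.integral_congr fun s hs => ?_
    rw [uIcc_of_le htT] at hs
    simp only [hYu s hs]
  rw [cost, cost, hquad, hcross, hrun_u, hYu T hTm]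
  linarith

omit [CompleteSpace H] in
lemma Admissible.sub_continuous {t T : ℝ} {u v : ℝ → H} (hv : Admissible t T v)
    (hu : Continuous u) : Admissible t T (v - u) := by
  refine ⟨hv.1.sub (hu.intervalIntegrable _ _), ?_⟩
  have hm : AEStronglyMeasurable (fun s => ‖(v - u) s‖ ^ 2) (volume.restrict (uIoc t T)) :=
    ((intervalIntegrable_iff.1 hv.1).1.sub hu.aestronglyMeasurable).norm.pow 2
  refine ((hv.2.const_mul 2).add
    (((hu.norm.pow 2).intervalIntegrable t T).const_mul 2)).mono_fun' hm ?_
  refine Filter.Eventually.of_forall fun s => ?_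
  simp only [Pi.sub_apply, Pi.pow_apply, norm_pow, norm_norm]
  have h1 := parallelogram_law_with_norm ℝ (v s) (u s)
  nlinarith [sq_nonneg ‖v s + u s‖]

/-- existence of an optimal control, and its uniqueness as an element of
`L²(t,T;H)` (i.e. up to a.e. equality on `(t,T)`). -/
theorem statement3
    (F FT : H → ℝ) (DF DFT : H → H) (c T lam : ℝ)
    (hF : ∀ X, HasGradientAt F (DF X) X) (hFT : ∀ X, HasGradientAt FT (DFT X) X)
    (hDF : ∀ X₁ X₂ : H, ‖DF X₁ - DF X₂‖ ≤ c * ‖X₁ - X₂‖)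
    (hDFT : ∀ X₁ X₂ : H, ‖DFT X₁ - DFT X₂‖ ≤ c * ‖X₁ - X₂‖)
    (hDF0 : ‖DF 0‖ ≤ c) (hDFT0 : ‖DFT 0‖ ≤ c)
    (hT : 0 < T) (hlam : 0 < lam)
    (hlc : c * T * (1 + T) < lam)
    (X : H) (t : ℝ) (ht : t ∈ Icc 0 T) :
    (∃ u : ℝ → H, Admissible t T u ∧
      ∀ v : ℝ → H, Admissible t T v → cost F FT lam X t T u ≤ cost F FT lam X t T v) ∧
    (∀ u₁ u₂ : ℝ → H, Admissible t T u₁ → Admissible t T u₂ →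
      (∀ v : ℝ → H, Admissible t T v → cost F FT lam X t T u₁ ≤ cost F FT lam X t T v) →
      (∀ v : ℝ → H, Admissible t T v → cost F FT lam X t T u₂ ≤ cost F FT lam X t T v) →
      ∀ᵐ s ∂volume.restrict (Ioc t T), u₁ s = u₂ s) := by
  have hc : 0 ≤ c := (norm_nonneg _).trans hDF0
  have htT : t ≤ T := ht.2
  have hτ : 0 ≤ T - t := sub_nonneg.2 htT
  have hle : c * (T - t) * (1 + (T - t)) ≤ c * T * (1 + T) := by
    have := ht.1
    gcongr <;> linarith
  have hlc' : c * (T - t) * (1 + (T - t)) < lam := hle.trans_lt hlc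
  obtain ⟨Y, hY, hYu⟩ := exists_optimality_system hc hDF hDFT hlam htT hlc' X
  set u : ℝ → H := fun σ => -(1 / lam) • adjZ DF DFT T Y σ with hu
  have huc : Continuous u :=
    (continuous_adjZ (continuous_of_norm_sub_le hDF) hY).const_smul _
  have huA : Admissible t T u :=
    ⟨huc.intervalIntegrable _ _, (huc.norm.pow 2).intervalIntegrable _ _⟩
  have key : ∀ v, Admissible t T v → cost F FT lam X t T u
      + (lam - c * (T - t) * (1 + (T - t))) / 2 * (∫ s in t..T, ‖(v - u) s‖ ^ 2)
        ≤ cost F FT lam X t T v := by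
    intro v hv
    have := cost_add_le hc hF hFT hDF hDFT hlam htT hY (fun _ => rfl) hYu
      (hv.sub_continuous huc)
    rwa [← hu, add_sub_cancel] at this
  have hκ : 0 < (lam - c * (T - t) * (1 + (T - t))) / 2 := half_pos (sub_pos.2 hlc')
  have hW : ∀ v : ℝ → H, 0 ≤ ∫ s in t..T, ‖(v - u) s‖ ^ 2 := fun v =>
    intervalIntegral.integral_nonneg htT fun _ _ => sq_nonneg _
  have huniq : ∀ v, Admissible t T v → cost F FT lam X t T v ≤ cost F FT lam X t T u →
      ∀ᵐ s ∂volume.restrict (Ioc t T), v s = u s := by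
    intro v hv hvu
    have h0 : ∫ s in t..T, ‖(v - u) s‖ ^ 2 = 0 := by
      have := key v hv
      refine le_antisymm (not_lt.1 fun hpos => ?_) (hW v)
      linarith [mul_pos hκ hpos]
    rw [intervalIntegral.integral_of_le htT, integral_eq_zero_iff_of_nonneg
      (fun _ => sq_nonneg _) ((intervalIntegrable_iff_integrableOn_Ioc_of_le htT).1
        (hv.sub_continuous huc).2)] at h0
    filter_upwards [h0] with s hs
    simpa [sub_eq_zero] using hs
  refine ⟨⟨u, huA, fun v hv => ?_⟩, fun u₁ u₂ h₁ h₂ hm₁ hm₂ => ?_⟩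
  · have := key v hv
    have := mul_nonneg hκ.le (hW v)
    linarith
  · filter_upwards [huniq u₁ h₁ (hm₁ u huA), huniq u₂ h₂ (hm₂ u huA)] with s hs₁ hs₂
    rw [hs₁, hs₂]
end

section
/- Assume λ > cT(1+T). Then for all X₁, X₂ in H and t in [0,T], |V(X₁,t) − V(X₂,t) − ((Z_{X₂t}(t), X₁−X₂))| ≤ c(T+1)[λ/(λ−cT(T+1)) + 1/2] ||X₁−X₂||². Consequently, for each t the value function V(.,t) is Fréchet differentiable on H with D_X V(X,t) = Z_{Xt}(t) = −λ u(t) (u(.) the optimal control for initial data (X,t)), and there is a constant C with ||D_X V(X,t)|| ≤ C(1+||X||). -/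
open MeasureTheory Set
open scoped RealInnerProductSpace

variable {H : Type*} [NormedAddCommGroup H] [InnerProductSpace ℝ H] [CompleteSpace H]

omit [CompleteSpace H] in
theorem IntervalIntegrable.continuousOn_inner {t T : ℝ} {g w : ℝ → H}
    (hw : IntervalIntegrable w volume t T) (hg : ContinuousOn g (uIcc t T)) :
    IntervalIntegrable (fun s => ⟪g s, w s⟫) volume t T := by
  obtain ⟨C, hC⟩ := isCompact_uIcc.exists_bound_of_continuousOn hg
  rw [intervalIntegrable_iff] at hw ⊢
  refine (hw.norm.const_mul C).mono' ?_ ?_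
  · exact ((hg.mono uIoc_subset_uIcc).aestronglyMeasurable measurableSet_uIoc).inner
      hw.aestronglyMeasurable
  · refine (ae_restrict_iff' measurableSet_uIoc).2 (Filter.Eventually.of_forall fun s hs => ?_)
    exact (norm_inner_le_norm _ _).trans
      (mul_le_mul_of_nonneg_right (hC s (uIoc_subset_uIcc hs)) (norm_nonneg _))

/-- Fubini on a triangle: integration by parts of two primitives against the inner product. -/
theorem integral_inner_primitive {t T : ℝ} (htT : t ≤ T) {g w : ℝ → H}
    (hg : IntervalIntegrable g volume t T) (hw : IntervalIntegrable w volume t T) :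
    ∫ s in t..T, ⟪g s, ∫ σ in t..s, w σ⟫ = ∫ σ in t..T, ⟪∫ s in σ..T, g s, w σ⟫ := by
  rw [intervalIntegrable_iff_integrableOn_Ioc_of_le htT] at hg hw
  set μ : Measure ℝ := volume.restrict (Ioc t T) with hμ
  have hprod : Integrable (fun p : ℝ × ℝ => ⟪g p.1, w p.2⟫) (μ.prod μ) := by
    refine (hg.norm.mul_prod hw.norm).mono'
      (hg.aestronglyMeasurable.comp_fst.inner hw.aestronglyMeasurable.comp_snd) ?_
    exact Filter.Eventually.of_forall fun p => norm_inner_le_norm _ _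
  have hind : Integrable (Function.uncurry fun s σ : ℝ =>
      {p : ℝ × ℝ | p.2 ≤ p.1}.indicator (fun p => ⟪g p.1, w p.2⟫) (s, σ)) (μ.prod μ) :=
    hprod.indicator (measurableSet_le measurable_snd measurable_fst)
  have hswap := integral_integral_swap hind
  rw [intervalIntegral.integral_of_le htT, intervalIntegral.integral_of_le htT]
  convert hswap using 1
  · refine setIntegral_congr_fun measurableSet_Ioc fun s hs => ?_
    have h1 : (fun σ => {p : ℝ × ℝ | p.2 ≤ p.1}.indicator (fun p => ⟪g p.1, w p.2⟫) (s, σ))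
        = (Iic s).indicator fun σ => ⟪g s, w σ⟫ := by
      ext σ; simp [indicator]
    have h2 : Ioc t T ∩ Iic s = Ioc t s := by
      ext x; simp only [mem_inter_iff, mem_Ioc, mem_Iic]
      exact ⟨fun h => ⟨h.1.1, h.2⟩, fun h => ⟨⟨h.1, h.2.trans hs.2⟩, h.2⟩⟩
    simp only [h1]
    rw [setIntegral_indicator measurableSet_Iic, h2, intervalIntegral.integral_of_le hs.1.le,
      integral_inner (hw.mono_set (Ioc_subset_Ioc_right hs.2))]
  · refine setIntegral_congr_fun measurableSet_Ioc fun σ hσ => ?_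
    have h1 : (fun s => {p : ℝ × ℝ | p.2 ≤ p.1}.indicator (fun p => ⟪g p.1, w p.2⟫) (s, σ))
        = (Ici σ).indicator fun s => ⟪w σ, g s⟫ := by
      ext s; simp [indicator, real_inner_comm]
    have h2 : Ioc t T ∩ Ici σ = Icc σ T := by
      ext x; simp only [mem_inter_iff, mem_Ioc, mem_Icc, mem_Ici]
      exact ⟨fun h => ⟨h.2, h.1.2⟩, fun h => ⟨⟨hσ.1.trans_le h.1, h.2⟩, h.1⟩⟩
    simp only [h1]
    rw [setIntegral_indicator measurableSet_Ici, h2, integral_Icc_eq_integral_Ioc,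
      integral_inner (hg.mono_set (Ioc_subset_Ioc_left hσ.1.le)),
      intervalIntegral.integral_of_le hσ.2, real_inner_comm]

/-- Second-order Taylor estimate for a functional with Lipschitz gradient. -/
theorem abs_sub_sub_inner_gradient_le {F : H → ℝ} {DF : H → H} {c : ℝ}
    (hF : ∀ X, HasGradientAt F (DF X) X)
    (hDF : ∀ X₁ X₂ : H, ‖DF X₁ - DF X₂‖ ≤ c * ‖X₁ - X₂‖) (y h : H) :
    |F (y + h) - F y - ⟪DF y, h⟫| ≤ c / 2 * ‖h‖ ^ 2 := by
  have hder : ∀ x : ℝ, HasDerivAt (fun x : ℝ => F (y + x • h) - F y - x * ⟪DF y, h⟫)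
      (⟪DF (y + x • h) - DF y, h⟫) x := by
    intro x
    have h1 : HasDerivAt (fun x : ℝ => y + x • h) h x := by
      simpa using ((hasDerivAt_id x).smul_const h).const_add y
    have h2 := (hF (y + x • h)).hasFDerivAt.comp_hasDerivAt x h1
    have h3 := (h2.sub_const (F y)).sub ((hasDerivAt_id x).mul_const ⟪DF y, h⟫)
    exact h3.congr_deriv (by simp [inner_sub_left])
  have hB : ∀ x : ℝ, HasDerivAt (fun x : ℝ => c / 2 * ‖h‖ ^ 2 * x ^ 2) (c * ‖h‖ ^ 2 * x) x := by
    intro x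
    exact ((hasDerivAt_pow 2 x).const_mul (c / 2 * ‖h‖ ^ 2)).congr_deriv (by simp; ring)
  have key := image_norm_le_of_norm_deriv_right_le_deriv_boundary' (a := (0 : ℝ)) (b := 1)
    (fun x _ => (hder x).continuousAt.continuousWithinAt)
    (fun x _ => (hder x).hasDerivWithinAt) (by simp)
    (fun x _ => (hB x).continuousAt.continuousWithinAt)
    (fun x _ => (hB x).hasDerivWithinAt) (fun x hx => by
      have hl := hDF (y + x • h) y
      rw [add_sub_cancel_left, norm_smul, Real.norm_of_nonneg hx.1] at hl
      calc ‖⟪DF (y + x • h) - DF y, h⟫‖ ≤ ‖DF (y + x • h) - DF y‖ * ‖h‖ := norm_inner_le_norm _ _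
        _ ≤ (c * (x * ‖h‖)) * ‖h‖ := by gcongr
        _ = c * ‖h‖ ^ 2 * x := by ring) (right_mem_Icc.2 zero_le_one)
  simpa using key

/-- Cauchy-Schwarz inequality on an interval. -/
theorem sq_integral_norm_le {E : Type*} [NormedAddCommGroup E] {t T : ℝ} (htT : t ≤ T) {w : ℝ → E}
    (hw : IntervalIntegrable w volume t T)
    (hw2 : IntervalIntegrable (fun s => ‖w s‖ ^ 2) volume t T) :
    (∫ s in t..T, ‖w s‖) ^ 2 ≤ (T - t) * ∫ s in t..T, ‖w s‖ ^ 2 := by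
  rcases htT.eq_or_lt with rfl | hlt
  · simp
  set B := ∫ s in t..T, ‖w s‖ with hB
  have hpos : 0 < T - t := sub_pos.2 hlt
  set m := B / (T - t) with hm
  have hBm : B = m * (T - t) := by rw [hm]; field_simp
  have h0 : 0 ≤ ∫ s in t..T, (‖w s‖ - m) ^ 2 :=
    intervalIntegral.integral_nonneg htT fun s _ => sq_nonneg _
  have h1 : ∫ s in t..T, (‖w s‖ - m) ^ 2
      = (∫ s in t..T, ‖w s‖ ^ 2) - 2 * m * B + (T - t) * m ^ 2 := by
    have : (fun s => (‖w s‖ - m) ^ 2) = fun s => ‖w s‖ ^ 2 - 2 * m * ‖w s‖ + m ^ 2 := by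
      ext s; ring
    rw [this, intervalIntegral.integral_add (hw2.sub (hw.norm.const_mul _)) (by simp),
      intervalIntegral.integral_sub hw2 (hw.norm.const_mul _),
      intervalIntegral.integral_const_mul, intervalIntegral.integral_const, smul_eq_mul]
  rw [h1] at h0
  rw [hBm] at h0 ⊢
  nlinarith

/-- Completion of the square. -/
theorem quadratic_le_of_sq_le {k T lam d A B : ℝ} (hT : 0 ≤ T)
    (hlam : k * T < lam) (hA : 0 ≤ A) (hB : B ^ 2 ≤ T * A) (hk : 0 ≤ k) :
    k * (d + B) ^ 2 ≤ lam * A + k * (lam / (lam - k * T)) * d ^ 2 := by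
  have hD : 0 < lam - k * T := sub_pos.2 hlam
  have key : 0 ≤ (lam - k * T) ^ 2 * A + k ^ 2 * T * d ^ 2 - 2 * k * (lam - k * T) * d * B := by
    rcases hT.eq_or_lt with rfl | hT
    · have : B = 0 := by
        rw [zero_mul] at hB
        exact pow_eq_zero_iff two_ne_zero |>.1 (le_antisymm hB (sq_nonneg B))
      subst this
      simpa using mul_nonneg (sq_nonneg lam) hA
    · refine nonneg_of_mul_nonneg_right (b := _) (a := T) ?_ hT
      have h1 := mul_le_mul_of_nonneg_left hB (sq_nonneg (lam - k * T))
      nlinarith [sq_nonneg ((lam - k * T) * B - k * T * d)]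
  have hkB := mul_le_mul_of_nonneg_left hB (mul_nonneg hk hD.le)
  have h2 : k * (lam / (lam - k * T)) * d ^ 2 = k * lam * d ^ 2 / (lam - k * T) := by ring
  rw [h2, ← sub_le_iff_le_add', le_div_iff₀ hD]
  nlinarith

section OptimalPath

variable {F FT : H → ℝ} {DF DFT : H → H} {c lam T t : ℝ} {X : H} {Y : ℝ → H}

theorem continuous_of_norm_sub_le_s9 {E : Type*} [NormedAddCommGroup E] {f : E → E} {c : ℝ}
    (hf : ∀ x y, ‖f x - f y‖ ≤ c * ‖x - y‖) : Continuous f :=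
  (LipschitzWith.of_dist_le' fun x y => by simpa [dist_eq_norm] using hf x y).continuous

omit [CompleteSpace H] in
theorem IsOptimalPath.continuousOn_adjZ (htT : t ≤ T) (hDF : Continuous DF)
    (hY : IsOptimalPath DF DFT lam T X t Y) : ContinuousOn (adjZ DF DFT T Y) (Icc t T) := by
  have h : ContinuousOn (fun s => DF (Y s)) (Icc t T) := hDF.comp_continuousOn hY.1
  have h2 := intervalIntegral.continuousOn_primitive_interval_left (a := t) (b := T)
    (μ := volume) (f := fun s => DF (Y s)) (by
      rw [uIcc_of_le htT]; exact h.integrableOn_Icc)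
  rw [uIcc_of_le htT] at h2
  exact continuousOn_const.add h2

/-- The optimal control `u = -Z/λ`. -/
noncomputable def optControl (DF DFT : H → H) (lam T : ℝ) (Y : ℝ → H) (s : ℝ) : H :=
  -(1 / lam) • adjZ DF DFT T Y s

omit [CompleteSpace H] in
theorem IsOptimalPath.continuousOn_optControl (htT : t ≤ T) (hDF : Continuous DF)
    (hY : IsOptimalPath DF DFT lam T X t Y) :
    ContinuousOn (optControl DF DFT lam T Y) (Icc t T) :=
  (hY.continuousOn_adjZ htT hDF).const_smul _

omit [CompleteSpace H] in
theorem IsOptimalPath.admissible_optControl (htT : t ≤ T) (hDF : Continuous DF)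
    (hY : IsOptimalPath DF DFT lam T X t Y) :
    Admissible t T (optControl DF DFT lam T Y) := by
  have h := hY.continuousOn_optControl htT hDF
  rw [← uIcc_of_le htT] at h
  exact ⟨h.intervalIntegrable, (h.norm.pow 2).intervalIntegrable⟩

theorem IsOptimalPath.integral_optControl (hDF : Continuous DF)
    (hY : IsOptimalPath DF DFT lam T X t Y) {s : ℝ} (hs : s ∈ Icc t T) :
    ∫ σ in t..s, optControl DF DFT lam T Y σ = Y s - X := by
  have htT := hs.1.trans hs.2
  rw [← hY.2.1]
  refine intervalIntegral.integral_eq_sub_of_hasDeriv_right_of_le hs.1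
    (hY.1.mono (Icc_subset_Icc_right hs.2)) (fun x hx => ?_) ?_
  · have hx' : x ∈ Ioo t T := ⟨hx.1, hx.2.trans_le hs.2⟩
    exact ((hY.2.2 x (Ioo_subset_Icc_self hx')).hasDerivAt
      (Icc_mem_nhds hx'.1 hx'.2)).hasDerivWithinAt
  · refine ContinuousOn.intervalIntegrable ?_
    rw [uIcc_of_le hs.1]
    exact (hY.continuousOn_optControl htT hDF).mono (Icc_subset_Icc_right hs.2)

theorem IsOptimalPath.state_optControl (hDF : Continuous DF)
    (hY : IsOptimalPath DF DFT lam T X t Y) {s : ℝ} (hs : s ∈ Icc t T) :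
    state X t (optControl DF DFT lam T Y) s = Y s := by
  rw [state, hY.integral_optControl hDF hs, add_sub_cancel]

theorem IsOptimalPath.state_eq (hDF : Continuous DF)
    (hY : IsOptimalPath DF DFT lam T X t Y) (X' : H) {v : ℝ → H}
    (hv : IntervalIntegrable v volume t T) {s : ℝ} (hs : s ∈ Icc t T) :
    state X' t v s =
      Y s + ((X' - X) + ∫ σ in t..s, (v σ - optControl DF DFT lam T Y σ)) := by
  have htT := hs.1.trans hs.2
  have hsub : uIcc t s ⊆ uIcc t T := by
    rw [uIcc_of_le hs.1, uIcc_of_le htT]; exact Icc_subset_Icc_right hs.2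
  rw [intervalIntegral.integral_sub (hv.mono_set hsub)
    ((hY.admissible_optControl htT hDF).1.mono_set hsub), hY.integral_optControl hDF hs, state]
  abel

/-- The control equation tested against a perturbation `w` of the control, with `u = -Z/λ`. -/
theorem IsOptimalPath.integral_inner_adjZ (htT : t ≤ T) (hDF : Continuous DF)
    (hY : IsOptimalPath DF DFT lam T X t Y) {w : ℝ → H} (hw : IntervalIntegrable w volume t T) :
    ∫ s in t..T, ⟪adjZ DF DFT T Y s, w s⟫ =
      ⟪DFT (Y T), ∫ s in t..T, w s⟫ + ∫ s in t..T, ⟪DF (Y s), ∫ σ in t..s, w σ⟫ := by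
  have hcont : ContinuousOn (fun s => DF (Y s)) (uIcc t T) := by
    rw [uIcc_of_le htT]; exact hDF.comp_continuousOn hY.1
  have hprim : ContinuousOn (fun s => ∫ σ in s..T, DF (Y σ)) (uIcc t T) :=
    intervalIntegral.continuousOn_primitive_interval_left (by
      rw [uIcc_of_le htT] at hcont ⊢; exact hcont.integrableOn_Icc)
  rw [integral_inner_primitive htT hcont.intervalIntegrable hw]
  simp only [adjZ, inner_add_left]
  have h1 : IntervalIntegrable (fun s => ⟪DFT (Y T), w s⟫) volume t T :=
    ⟨hw.1.const_inner _, hw.2.const_inner _⟩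
  rw [intervalIntegral.integral_add h1 (hw.continuousOn_inner hprim)]
  congr 1
  simp only [intervalIntegral.integral_of_le htT]
  exact integral_inner hw.1 _

omit [CompleteSpace H] in
theorem IsOptimalPath.intervalIntegrable_norm_sq_sub (htT : t ≤ T) (hDF : Continuous DF)
    (hY : IsOptimalPath DF DFT lam T X t Y) {v : ℝ → H} (hv : Admissible t T v) :
    IntervalIntegrable (fun s => ‖v s - optControl DF DFT lam T Y s‖ ^ 2) volume t T := by
  have hu := hY.admissible_optControl htT hDF
  have huc := hY.continuousOn_optControl htT hDF
  rw [← uIcc_of_le htT] at huc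
  have h := (hv.2.sub ((hv.1.continuousOn_inner huc).const_mul 2)).add hu.2
  refine h.congr fun s _ => ?_
  simp only [norm_sub_sq_real, real_inner_comm (v s)]

omit [CompleteSpace H] in
theorem IsOptimalPath.integral_norm_sq_eq (htT : t ≤ T) (hlam : lam ≠ 0) (hDF : Continuous DF)
    (hY : IsOptimalPath DF DFT lam T X t Y) {v : ℝ → H} (hv : Admissible t T v) :
    lam / 2 * (∫ s in t..T, ‖v s‖ ^ 2) =
      lam / 2 * (∫ s in t..T, ‖optControl DF DFT lam T Y s‖ ^ 2) +
      lam / 2 * (∫ s in t..T, ‖v s - optControl DF DFT lam T Y s‖ ^ 2) -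
      ∫ s in t..T, ⟪adjZ DF DFT T Y s, v s - optControl DF DFT lam T Y s⟫ := by
  have hu := hY.admissible_optControl htT hDF
  have hZ := hY.continuousOn_adjZ htT hDF
  rw [← uIcc_of_le htT] at hZ
  rw [← intervalIntegral.integral_const_mul, ← intervalIntegral.integral_const_mul,
    ← intervalIntegral.integral_const_mul,
    ← intervalIntegral.integral_add (hu.2.const_mul _)
      ((hY.intervalIntegrable_norm_sq_sub htT hDF hv).const_mul _),
    ← intervalIntegral.integral_sub ((hu.2.const_mul _).add
      ((hY.intervalIntegrable_norm_sq_sub htT hDF hv).const_mul _))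
      ((hv.1.sub hu.1).continuousOn_inner hZ)]
  refine intervalIntegral.integral_congr fun s _ => ?_
  set u := optControl DF DFT lam T Y s with hus
  have hz : adjZ DF DFT T Y s = (-lam) • u := by
    rw [hus, optControl, smul_smul]
    simp [hlam]
  simp only [hz, norm_sub_sq_real, real_inner_smul_left, inner_sub_right,
    real_inner_self_eq_norm_sq, real_inner_comm u (v s)]
  ring

/-- First-order expansion of the cost around the optimal control. -/
theorem IsOptimalPath.abs_cost_sub_le (htT : t ≤ T) (hlam : lam ≠ 0)
    (hF : ∀ X, HasGradientAt F (DF X) X) (hFT : ∀ X, HasGradientAt FT (DFT X) X)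
    (hc : 0 ≤ c) (hDF : ∀ X₁ X₂ : H, ‖DF X₁ - DF X₂‖ ≤ c * ‖X₁ - X₂‖)
    (hDFT : ∀ X₁ X₂ : H, ‖DFT X₁ - DFT X₂‖ ≤ c * ‖X₁ - X₂‖)
    (hY : IsOptimalPath DF DFT lam T X t Y) (X' : H) {v : ℝ → H} (hv : Admissible t T v) :
    |cost F FT lam X' t T v - cost F FT lam X t T (optControl DF DFT lam T Y) -
        ⟪adjZ DF DFT T Y t, X' - X⟫ -
        lam / 2 * ∫ s in t..T, ‖v s - optControl DF DFT lam T Y s‖ ^ 2| ≤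
      c / 2 * (T - t + 1) *
        (‖X' - X‖ + ∫ s in t..T, ‖v s - optControl DF DFT lam T Y s‖) ^ 2 := by
  have hDFc : Continuous DF := continuous_of_norm_sub_le_s9 hDF
  have hFc : Continuous F := continuous_iff_continuousAt.2 fun x => (hF x).continuousAt
  set u := optControl DF DFT lam T Y with hu
  set w : ℝ → H := fun s => v s - u s with hw
  have hwi : IntervalIntegrable w volume t T := hv.1.sub (hY.admissible_optControl htT hDFc).1
  set W : ℝ → H := fun s => ∫ σ in t..s, w σ with hW
  have hWc : ContinuousOn W (Icc t T) := by
    have := intervalIntegral.continuousOn_primitive_interval' hwi left_mem_uIcc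
    rwa [uIcc_of_le htT] at this
  set δ := X' - X with hδ
  set R := ‖δ‖ + ∫ s in t..T, ‖w s‖ with hR
  have hWR : ∀ s ∈ Icc t T, ‖δ + W s‖ ≤ R := fun s hs => by
    refine (norm_add_le _ _).trans (add_le_add_right ?_ _)
    refine (intervalIntegral.norm_integral_le_integral_norm hs.1).trans ?_
    exact intervalIntegral.integral_mono_interval le_rfl hs.1 hs.2
      (Filter.Eventually.of_forall fun _ => norm_nonneg _) hwi.norm
  have taylor : ∀ {G : H → ℝ} {DG : H → H}, (∀ X, HasGradientAt G (DG X) X) →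
      (∀ X₁ X₂ : H, ‖DG X₁ - DG X₂‖ ≤ c * ‖X₁ - X₂‖) → ∀ s ∈ Icc t T,
      |G (Y s + (δ + W s)) - G (Y s) - ⟪DG (Y s), δ + W s⟫| ≤ c / 2 * R ^ 2 :=
    fun hG hDG s hs => (abs_sub_sub_inner_gradient_le hG hDG _ _).trans (by
      have := hWR s hs
      gcongr)
  have hii : ∀ {f : ℝ → ℝ}, ContinuousOn f (Icc t T) → IntervalIntegrable f volume t T :=
    fun h => ContinuousOn.intervalIntegrable (by rwa [uIcc_of_le htT])
  have hDFY : ContinuousOn (fun s => DF (Y s)) (Icc t T) := hDFc.comp_continuousOn hY.1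
  have hi1 : IntervalIntegrable (fun s => F (Y s + (δ + W s))) volume t T :=
    hii (hFc.comp_continuousOn (hY.1.add (continuousOn_const.add hWc)))
  have hi2 : IntervalIntegrable (fun s => F (Y s)) volume t T :=
    hii (hFc.comp_continuousOn hY.1)
  have hi3 : IntervalIntegrable (fun s => ⟪DF (Y s), W s⟫) volume t T :=
    hii (hDFY.inner hWc)
  have hi4 : IntervalIntegrable (fun s => ⟪DF (Y s), δ⟫) volume t T :=
    hii (hDFY.inner continuousOn_const)
  have hi5 : IntervalIntegrable (fun s => DF (Y s)) volume t T :=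
    ContinuousOn.intervalIntegrable (by rwa [uIcc_of_le htT])
  have hrun := intervalIntegral.norm_integral_le_of_norm_le_const (a := t) (b := T)
    (C := c / 2 * R ^ 2)
    (f := fun s => F (Y s + (δ + W s)) - F (Y s) - (⟪DF (Y s), δ⟫ + ⟪DF (Y s), W s⟫))
    fun s hs => by
      rw [uIoc_of_le htT] at hs
      rw [← inner_add_right]
      exact taylor hF hDF s (Ioc_subset_Icc_self hs)
  rw [intervalIntegral.integral_sub (hi1.sub hi2) (hi4.add hi3),
    intervalIntegral.integral_sub hi1 hi2, intervalIntegral.integral_add hi4 hi3,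
    abs_of_nonneg (sub_nonneg.2 htT), Real.norm_eq_abs] at hrun
  have hend := taylor hFT hDFT T (right_mem_Icc.2 htT)
  rw [inner_add_right] at hend
  have hZw := hY.integral_inner_adjZ htT hDFc hwi
  have hsq := hY.integral_norm_sq_eq htT hlam hDFc hv
  have hZδ : ⟪adjZ DF DFT T Y t, δ⟫ = ⟪DFT (Y T), δ⟫ + ∫ s in t..T, ⟪DF (Y s), δ⟫ := by
    rw [adjZ, inner_add_left]
    congr 1
    simp only [real_inner_comm δ, intervalIntegral.integral_of_le htT]
    exact (integral_inner hi5.1 δ).symm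
  have hcost' : cost F FT lam X' t T v = lam / 2 * (∫ s in t..T, ‖v s‖ ^ 2) +
      (∫ s in t..T, F (Y s + (δ + W s))) + FT (Y T + (δ + W T)) := by
    rw [cost, hY.state_eq hDFc X' hv.1 (right_mem_Icc.2 htT)]
    congr 2
    refine intervalIntegral.integral_congr fun s hs => ?_
    rw [uIcc_of_le htT] at hs
    simp only [hY.state_eq hDFc X' hv.1 hs]
    rfl
  have hcost : cost F FT lam X t T u = lam / 2 * (∫ s in t..T, ‖u s‖ ^ 2) +
      (∫ s in t..T, F (Y s)) + FT (Y T) := by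
    rw [cost, hY.state_optControl hDFc (right_mem_Icc.2 htT)]
    congr 2
    refine intervalIntegral.integral_congr fun s hs => ?_
    rw [uIcc_of_le htT] at hs
    simp only [hu, hY.state_optControl hDFc hs]
  rw [hcost', hcost, hZδ]
  rw [abs_le] at hrun hend ⊢
  constructor <;> linarith [hrun.1, hrun.2, hend.1, hend.2]

/-- Two-sided quadratic estimate of the value function around the starting point of an optimal
path. -/
theorem IsOptimalPath.abs_valueFn_sub_le (ht0 : 0 ≤ t) (htT : t ≤ T) (hlam : 0 < lam)
    (hlc : c * T * (1 + T) < lam)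
    (hF : ∀ X, HasGradientAt F (DF X) X) (hFT : ∀ X, HasGradientAt FT (DFT X) X)
    (hc : 0 ≤ c) (hDF : ∀ X₁ X₂ : H, ‖DF X₁ - DF X₂‖ ≤ c * ‖X₁ - X₂‖)
    (hDFT : ∀ X₁ X₂ : H, ‖DFT X₁ - DFT X₂‖ ≤ c * ‖X₁ - X₂‖)
    (hY : IsOptimalPath DF DFT lam T X t Y) (X' : H) :
    |valueFn F FT lam T X' t - valueFn F FT lam T X t - ⟪adjZ DF DFT T Y t, X' - X⟫| ≤
      c * (T + 1) / 2 * (lam / (lam - c * T * (T + 1))) * ‖X' - X‖ ^ 2 := by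
  have hDFc : Continuous DF := continuous_of_norm_sub_le_s9 hDF
  set u := optControl DF DFT lam T Y with hu
  have hua : Admissible t T u := hY.admissible_optControl htT hDFc
  have hden : 0 < lam - c * T * (T + 1) := by linarith
  have hT0 : 0 ≤ T := ht0.trans htT
  set K := c * (T + 1) / 2 * (lam / (lam - c * T * (T + 1))) with hK
  have hKge : c * (T + 1) / 2 ≤ K := by
    refine le_mul_of_one_le_right (by positivity) ?_
    rw [one_le_div hden]
    have : 0 ≤ c * T * (T + 1) := by positivity
    linarith
  have lower : ∀ X'' : H, ∀ v, Admissible t T v → cost F FT lam X t T u +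
      ⟪adjZ DF DFT T Y t, X'' - X⟫ - K * ‖X'' - X‖ ^ 2 ≤ cost F FT lam X'' t T v := by
    intro X'' v hv
    have h := (abs_le.1 (hY.abs_cost_sub_le htT hlam.ne' hF hFT hc hDF hDFT X'' hv)).1
    have hcs := sq_integral_norm_le htT
      (hv.1.sub hua.1) (hY.intervalIntegrable_norm_sq_sub htT hDFc hv)
    rw [← hu] at h
    set A := ∫ s in t..T, ‖v s - u s‖ ^ 2 with hA
    set B := ∫ s in t..T, ‖v s - u s‖ with hB
    set d := ‖X'' - X‖ with hd
    have hA0 : 0 ≤ A := intervalIntegral.integral_nonneg htT fun s _ => sq_nonneg _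
    have hB2 : B ^ 2 ≤ T * A := hcs.trans (by gcongr; linarith)
    have hquad : c / 2 * (T + 1) * (d + B) ^ 2 ≤ lam / 2 * A + K * d ^ 2 := by
      have hD := quadratic_le_of_sq_le (k := c * (T + 1)) (lam := lam) (d := d) hT0 (by linarith) hA0 hB2 (by positivity)
      calc c / 2 * (T + 1) * (d + B) ^ 2 = (c * (T + 1) * (d + B) ^ 2) / 2 := by ring
        _ ≤ (lam * A + c * (T + 1) * (lam / (lam - c * (T + 1) * T)) * d ^ 2) / 2 := by linarith
        _ = lam / 2 * A + K * d ^ 2 := by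
          rw [hK, show c * (T + 1) * T = c * T * (T + 1) by ring]; ring
    have hmono : c / 2 * (T - t + 1) * (d + B) ^ 2 ≤ c / 2 * (T + 1) * (d + B) ^ 2 := by
      gcongr; linarith
    linarith
  have hbdd : ∀ X'' : H, BddBelow ((fun v => cost F FT lam X'' t T v) '' {v | Admissible t T v}) :=
    fun X'' => ⟨_, by rintro _ ⟨v, hv, rfl⟩; exact lower X'' v hv⟩
  have hV : valueFn F FT lam T X t = cost F FT lam X t T u := by
    refine le_antisymm (csInf_le (hbdd X) ⟨u, hua, rfl⟩) (le_csInf ⟨_, u, hua, rfl⟩ ?_)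
    rintro _ ⟨v, hv, rfl⟩
    simpa using lower X v hv
  have hup : valueFn F FT lam T X' t ≤ cost F FT lam X' t T u :=
    csInf_le (hbdd X') ⟨u, hua, rfl⟩
  have hlow : cost F FT lam X t T u + ⟪adjZ DF DFT T Y t, X' - X⟫ - K * ‖X' - X‖ ^ 2 ≤
      valueFn F FT lam T X' t := by
    refine le_csInf ⟨_, u, hua, rfl⟩ ?_
    rintro _ ⟨v, hv, rfl⟩
    exact lower X' v hv
  have h := (abs_le.1 (hY.abs_cost_sub_le htT hlam.ne' hF hFT hc hDF hDFT X' hua)).2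
  simp only [← hu, sub_self, norm_zero, intervalIntegral.integral_zero, ne_eq, OfNat.ofNat_ne_zero,
    not_false_eq_true, zero_pow, mul_zero, sub_zero, add_zero] at h
  have h2 : c / 2 * (T - t + 1) * ‖X' - X‖ ^ 2 ≤ K * ‖X' - X‖ ^ 2 := by
    refine mul_le_mul_of_nonneg_right (le_trans ?_ hKge) (sq_nonneg _)
    nlinarith
  rw [hV, abs_le]
  constructor <;> linarith

omit [CompleteSpace H] in
/-- A priori bound on the adjoint state at the initial time. -/
theorem IsOptimalPath.norm_adjZ_le (ht0 : 0 ≤ t) (htT : t ≤ T) (hlam : 0 < lam)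
    (hlc : c * T * (1 + T) < lam) (hDF0 : ‖DF 0‖ ≤ c) (hDFT0 : ‖DFT 0‖ ≤ c)
    (hDF : ∀ X₁ X₂ : H, ‖DF X₁ - DF X₂‖ ≤ c * ‖X₁ - X₂‖)
    (hDFT : ∀ X₁ X₂ : H, ‖DFT X₁ - DFT X₂‖ ≤ c * ‖X₁ - X₂‖)
    (hY : IsOptimalPath DF DFT lam T X t Y) :
    ‖adjZ DF DFT T Y t‖ ≤ c * (T + 1) * (lam / (lam - c * T * (1 + T))) * (1 + ‖X‖) := by
  have hT0 : 0 ≤ T := ht0.trans htT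
  have hc : 0 ≤ c := (norm_nonneg _).trans hDF0
  have hden : 0 < lam - c * T * (1 + T) := by linarith
  obtain ⟨r, hr, hmax⟩ := isCompact_Icc.exists_isMaxOn (nonempty_Icc.2 htT) hY.1.norm
  set M := ‖Y r‖ with hM
  have hM0 : 0 ≤ M := norm_nonneg _
  have hlin : ∀ {G : H → H}, ‖G 0‖ ≤ c → (∀ X₁ X₂ : H, ‖G X₁ - G X₂‖ ≤ c * ‖X₁ - X₂‖) →
      ∀ s ∈ Icc t T, ‖G (Y s)‖ ≤ c * (1 + M) := fun {G} hG0 hG s hs => by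
    have h1 := hG (Y s) 0
    have h2 := norm_sub_norm_le (G (Y s)) (G 0)
    have h3 : ‖Y s‖ ≤ M := hmax hs
    have h4 := mul_le_mul_of_nonneg_left h3 hc
    rw [sub_zero] at h1
    linarith
  have hZ : ∀ s ∈ Icc t T, ‖adjZ DF DFT T Y s‖ ≤ c * (T + 1) * (1 + M) := fun s hs => by
    have h1 := hlin hDFT0 hDFT T (right_mem_Icc.2 htT)
    have h2 : ‖∫ σ in s..T, DF (Y σ)‖ ≤ c * (1 + M) * |T - s| :=
      intervalIntegral.norm_integral_le_of_norm_le_const fun σ hσ => by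
        rw [uIoc_of_le hs.2] at hσ
        exact hlin hDF0 hDF σ ⟨hs.1.trans hσ.1.le, hσ.2⟩
    rw [abs_of_nonneg (sub_nonneg.2 hs.2)] at h2
    have h3 : c * (1 + M) * (T - s) ≤ c * (1 + M) * T := by
      gcongr; linarith [hs.1]
    calc ‖adjZ DF DFT T Y s‖ ≤ _ := norm_add_le _ _
      _ ≤ c * (T + 1) * (1 + M) := by linarith
  have hMle : M ≤ ‖X‖ + 1 / lam * (c * (T + 1) * (1 + M)) * T := by
    have h1 := Convex.norm_image_sub_le_of_norm_hasDerivWithin_le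
      (C := 1 / lam * (c * (T + 1) * (1 + M))) hY.2.2 (fun s hs => by
        rw [norm_smul, norm_neg, Real.norm_of_nonneg (by positivity)]
        exact mul_le_mul_of_nonneg_left (hZ s hs) (by positivity))
      (convex_Icc t T) (left_mem_Icc.2 htT) hr
    rw [hY.2.1, Real.norm_of_nonneg (sub_nonneg.2 hr.1)] at h1
    have h2 := norm_sub_norm_le (Y r) X
    have h3 : 1 / lam * (c * (T + 1) * (1 + M)) * (r - t) ≤
        1 / lam * (c * (T + 1) * (1 + M)) * T := by
      gcongr; linarith [hr.2]
    linarith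
  have hM1 : 1 + M ≤ lam / (lam - c * T * (1 + T)) * (1 + ‖X‖) := by
    rw [div_mul_eq_mul_div, le_div_iff₀ hden]
    have : lam * M ≤ lam * (‖X‖ + 1 / lam * (c * (T + 1) * (1 + M)) * T) := by gcongr
    have h2 : lam * (‖X‖ + 1 / lam * (c * (T + 1) * (1 + M)) * T) =
        lam * ‖X‖ + c * (T + 1) * (1 + M) * T := by field_simp
    linarith
  calc ‖adjZ DF DFT T Y t‖ ≤ c * (T + 1) * (1 + M) := hZ t (left_mem_Icc.2 htT)
    _ ≤ c * (T + 1) * (lam / (lam - c * T * (1 + T)) * (1 + ‖X‖)) := by gcongr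
    _ = _ := by ring

end OptimalPath

/-- A quadratic first-order remainder gives differentiability. -/
theorem hasGradientAt_of_abs_sub_le {f : H → ℝ} {g x : H} {K : ℝ}
    (h : ∀ y, |f y - f x - ⟪g, y - x⟫| ≤ K * ‖y - x‖ ^ 2) : HasGradientAt f g x := by
  rw [hasGradientAt_iff_isLittleO]
  have h1 : (fun y => f y - f x - ⟪g, y - x⟫) =O[nhds x] fun y => ‖y - x‖ ^ 2 :=
    Asymptotics.IsBigO.of_bound K (Filter.Eventually.of_forall fun y => by
      simpa using h y)
  refine h1.trans_isLittleO ?_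
  have h2 : Filter.Tendsto (fun y => y - x) (nhds x) (nhds 0) := by
    have : Continuous fun y => y - x := by fun_prop
    simpa using this.tendsto x
  exact (Asymptotics.isLittleO_norm_pow_id one_lt_two).comp_tendsto h2

/-- the first-order expansion of the value function in `X`; consequently
`V(·,t)` is Fréchet differentiable with gradient `D_X V(X,t) = Z_{Xt}(t) = -λ u(t)`, and the
gradient grows at most linearly. -/
theorem statement9
    (F FT : H → ℝ) (DF DFT : H → H) (c T lam : ℝ)
    (hF : ∀ X, HasGradientAt F (DF X) X) (hFT : ∀ X, HasGradientAt FT (DFT X) X)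
    (hDF : ∀ X₁ X₂ : H, ‖DF X₁ - DF X₂‖ ≤ c * ‖X₁ - X₂‖)
    (hDFT : ∀ X₁ X₂ : H, ‖DFT X₁ - DFT X₂‖ ≤ c * ‖X₁ - X₂‖)
    (hDF0 : ‖DF 0‖ ≤ c) (hDFT0 : ‖DFT 0‖ ≤ c)
    (hT : 0 < T) (hlam : 0 < lam)
    (hlc : c * T * (1 + T) < lam) :
    (∀ t ∈ Icc 0 T, ∀ X₁ X₂ : H, ∀ Y₁ Y₂ : ℝ → H,
      IsOptimalPath DF DFT lam T X₁ t Y₁ → IsOptimalPath DF DFT lam T X₂ t Y₂ →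
      |valueFn F FT lam T X₁ t - valueFn F FT lam T X₂ t -
          ⟪adjZ DF DFT T Y₂ t, X₁ - X₂⟫| ≤
        c * (T + 1) * (lam / (lam - c * T * (T + 1)) + 1 / 2) * ‖X₁ - X₂‖ ^ 2) ∧
    (∀ t ∈ Icc 0 T, ∀ X : H, ∀ Y : ℝ → H, IsOptimalPath DF DFT lam T X t Y →
      HasGradientAt (fun X' => valueFn F FT lam T X' t) (adjZ DF DFT T Y t) X ∧
      adjZ DF DFT T Y t = (-lam) • (-(1 / lam) • adjZ DF DFT T Y t)) ∧
    (∃ C : ℝ, ∀ t ∈ Icc 0 T, ∀ X : H, ∀ Y : ℝ → H, IsOptimalPath DF DFT lam T X t Y →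
      ‖adjZ DF DFT T Y t‖ ≤ C * (1 + ‖X‖)) := by
  have hc : 0 ≤ c := (norm_nonneg _).trans hDF0
  have hden : 0 < lam - c * T * (T + 1) := by linarith
  refine ⟨fun t ht X₁ X₂ Y₁ Y₂ _ hY₂ => ?_, fun t ht X Y hY => ⟨?_, ?_⟩, _,
    fun t ht X Y hY => hY.norm_adjZ_le ht.1 ht.2 hlam hlc hDF0 hDFT0 hDF hDFT⟩
  · refine (hY₂.abs_valueFn_sub_le ht.1 ht.2 hlam hlc hF hFT hc hDF hDFT X₁).trans ?_
    refine mul_le_mul_of_nonneg_right ?_ (sq_nonneg _)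
    rw [div_mul_eq_mul_div, mul_div_assoc]
    refine mul_le_mul_of_nonneg_left ?_ (by positivity)
    have : 0 < lam / (lam - c * T * (T + 1)) := by positivity
    linarith
  · exact hasGradientAt_of_abs_sub_le
      (hY.abs_valueFn_sub_le ht.1 ht.2 hlam hlc hF hFT hc hDF hDFT)
  · rw [smul_smul]
    simp [hlam.ne']
end

section
/- Assume λ > cT(1+T). Let W : H×[0,T] → ℝ be C¹, satisfying |W(X,t)| ≤ C(1+||X||²), ||D_X W(X,t)|| ≤ C(1+||X||), |∂W/∂t(X,t)| ≤ C(1+||X||²), ||D_X W(X₁,t₁) − D_X W(X₂,t₂)|| ≤ C||X₁−X₂|| + C|t₁−t₂|(1+||X₁||+||X₂||), and solving the Hamilton–Jacobi–Bellman equation ∂W/∂t − (1/(2λ))||D_X W||² + F(X) = 0 with W(X,T) = F_T(X). Then: (i) for every control v(.) ∈ L²(t,T;H), W(X,t) ≤ J_{X,t}(v(.)); (ii) the feedback equation dX̂/ds = −(1/λ) D_X W(X̂(s),s), X̂(t) = X has a unique solution, and with v̂(s) = −(1/λ) D_X W(X̂(s),s) one has W(X,t) = J_{X,t}(v̂(.));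 hence W coincides with the value function V, i.e., the HJB equation has at most one solution in this class. -/
open MeasureTheory Set
open scoped RealInnerProductSpace

variable {H : Type*} [NormedAddCommGroup H] [InnerProductSpace ℝ H] [CompleteSpace H]

open Filter Topology NNReal

/-- A map dominated by an absolutely continuous map is absolutely continuous. -/
theorem AbsolutelyContinuousOnInterval.of_dist_le {X Y : Type*} [PseudoMetricSpace X]
    [PseudoMetricSpace Y] {f : ℝ → X} {g : ℝ → Y} {a b : ℝ}
    (hg : AbsolutelyContinuousOnInterval g a b)
    (h : ∀ x ∈ uIcc a b, ∀ y ∈ uIcc a b, dist (f x) (f y) ≤ dist (g x) (g y)) :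
    AbsolutelyContinuousOnInterval f a b := by
  rw [absolutelyContinuousOnInterval_iff] at hg ⊢
  intro ε hε
  obtain ⟨δ, hδ, H⟩ := hg ε hε
  refine ⟨δ, hδ, fun E hE hEδ => (Finset.sum_le_sum fun i hi => ?_).trans_lt (H E hE hEδ)⟩
  exact h _ (hE.1 i hi).1 _ (hE.1 i hi).2

/-- Global existence for an ODE whose right-hand side is globally Lipschitz in space. -/
theorem exists_forall_hasDerivWithinAt_of_lipschitzWith {E : Type*} [NormedAddCommGroup E]
    [NormedSpace ℝ E] [CompleteSpace E] {f : ℝ → E → E} {K : ℝ≥0} {a b : ℝ} (hab : a ≤ b)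
    (hcont : ContinuousOn (fun p : ℝ × E => f p.1 p.2) (Icc a b ×ˢ univ))
    (hlip : ∀ t ∈ Icc a b, LipschitzWith K (f t)) (x : E) :
    ∃ α : ℝ → E, α a = x ∧
      ∀ t ∈ Icc a b, HasDerivWithinAt α (f t (α t)) (Icc a b) t := by
  have hproj : Continuous fun σ : ℝ => (projIcc a b hab σ : ℝ) :=
    continuous_subtype_val.comp continuous_projIcc
  set M : ℝ := 2 * K + 1 with hM
  have hMpos : 0 < M := by positivity
  let u (y : C(Icc a b, E)) (σ : ℝ) : E := Real.exp (M * σ) • y (projIcc a b hab σ)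
  let h (y : C(Icc a b, E)) (σ : ℝ) : E := f (projIcc a b hab σ) (u y σ)
  have hu (y) : Continuous (u y) :=
    (by fun_prop : Continuous fun σ : ℝ => Real.exp (M * σ)).smul
      (y.continuous.comp continuous_projIcc)
  have hh (y) : Continuous (h y) :=
    hcont.comp_continuous (hproj.prodMk (hu y)) fun σ => ⟨(projIcc a b hab σ).2, mem_univ _⟩
  have hI (y) : Continuous fun s => ∫ σ in a..s, h y σ :=
    intervalIntegral.continuous_primitive (fun _ _ => (hh y).intervalIntegrable _ _) a
  let Φ (y : C(Icc a b, E)) : C(Icc a b, E) :=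
    ⟨fun s => Real.exp (-(M * s)) • (x + ∫ σ in a..s, h y σ), by
      have := (hI y).comp (continuous_subtype_val (p := fun s => s ∈ Icc a b))
      exact Continuous.smul (by fun_prop) (continuous_const.add this)⟩
  have hdist (y z : C(Icc a b, E)) (σ : ℝ) :
      ‖h y σ - h z σ‖ ≤ K * ‖y - z‖ * Real.exp (M * σ) := by
    have h1 := (hlip _ (projIcc a b hab σ).2).dist_le_mul (u y σ) (u z σ)
    rw [dist_eq_norm, dist_eq_norm] at h1
    refine h1.trans ?_
    have h2 : ‖u y σ - u z σ‖ ≤ Real.exp (M * σ) * ‖y - z‖ := by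
      simp only [u]
      rw [← smul_sub, norm_smul, Real.norm_of_nonneg (Real.exp_pos _).le]
      gcongr
      exact (y - z).norm_coe_le_norm _
    calc (K : ℝ) * ‖u y σ - u z σ‖ ≤ K * (Real.exp (M * σ) * ‖y - z‖) := by gcongr
      _ = _ := by ring
  have hexp (s : ℝ) : ∫ σ in a..s, Real.exp (M * σ) =
      (Real.exp (M * s) - Real.exp (M * a)) / M := by
    rw [intervalIntegral.integral_comp_mul_left _ hMpos.ne', integral_exp]
    simp [div_eq_inv_mul]
  have hΦ : ContractingWith (1 / 2) Φ := by
    refine ⟨by rw [← NNReal.coe_lt_coe]; norm_num, LipschitzWith.of_dist_le_mul fun y z => ?_⟩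
    rw [ContinuousMap.dist_le (by positivity)]
    intro s
    rw [dist_eq_norm, dist_eq_norm]
    have h1 : ‖(∫ σ in a..s, h y σ) - ∫ σ in a..s, h z σ‖ ≤
        K * ‖y - z‖ * ((Real.exp (M * s) - Real.exp (M * a)) / M) := by
      rw [← intervalIntegral.integral_sub ((hh y).intervalIntegrable _ _)
        ((hh z).intervalIntegrable _ _), ← hexp, ← intervalIntegral.integral_const_mul]
      exact intervalIntegral.norm_integral_le_of_norm_le s.2.1
        (Eventually.of_forall fun σ _ => hdist y z σ)
        (Continuous.intervalIntegrable (by fun_prop) _ _)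
    have h2 : Φ y s - Φ z s =
        Real.exp (-(M * s)) • ((∫ σ in a..s, h y σ) - ∫ σ in a..s, h z σ) := by
      simp [Φ, ← smul_sub]
    rw [h2, norm_smul, Real.norm_of_nonneg (Real.exp_pos _).le]
    calc _ ≤ Real.exp (-(M * s)) * (K * ‖y - z‖ * (Real.exp (M * s) / M)) := by
          refine mul_le_mul_of_nonneg_left (h1.trans ?_) (Real.exp_pos _).le
          gcongr
          linarith [Real.exp_pos (M * a)]
      _ = K / M * ‖y - z‖ := by
          rw [Real.exp_neg]
          field_simp
      _ ≤ _ := by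
          refine mul_le_mul_of_nonneg_right ?_ (norm_nonneg _)
          rw [div_le_iff₀ hMpos]
          push_cast
          linarith
  have hfix := hΦ.fixedPoint_isFixedPt
  set y := ContractingWith.fixedPoint Φ hΦ
  have hint : ∀ s ∈ Icc a b, u y s = x + ∫ σ in a..s, h y σ := by
    intro s hs
    have h1 : y ⟨s, hs⟩ = Real.exp (-(M * s)) • (x + ∫ σ in a..s, h y σ) :=
      (DFunLike.congr_fun hfix ⟨s, hs⟩).symm
    simp only [u]
    rw [projIcc_of_mem hab hs, h1, smul_smul, ← Real.exp_add]
    simp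
  refine ⟨u y, by simp [hint a (left_mem_Icc.2 hab)], fun s hs => ?_⟩
  have h1 : HasDerivAt (fun s => x + ∫ σ in a..s, h y σ) (h y s) s :=
    ((hh y).integral_hasStrictDerivAt a s).hasDerivAt.const_add x
  have h2 : h y s = f s (u y s) := by simp only [h]; rw [projIcc_of_mem hab hs]
  rw [← h2]
  exact h1.hasDerivWithinAt.congr hint (hint s hs)

/-- Almost everywhere chain rule for a `C¹` function along the path of an integrable control. -/
theorem absolutelyContinuousOnInterval_comp_state {W : H → ℝ → ℝ} {GW : H → ℝ → H}
    {Wt : H → ℝ → ℝ} {T t : ℝ} {X : H} {v : ℝ → H} (ht : t ∈ Icc 0 T)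
    (hGW : ∀ X : H, ∀ t ∈ Icc 0 T, HasGradientAt (fun X' => W X' t) (GW X t) X)
    (hWt : ∀ X : H, ∀ t ∈ Icc 0 T,
      HasDerivWithinAt (fun τ => W X τ) (Wt X t) (Icc 0 T) t)
    (hGWc : ContinuousOn (fun p : H × ℝ => GW p.1 p.2) (univ ×ˢ Icc 0 T))
    (hWtc : ContinuousOn (fun p : H × ℝ => Wt p.1 p.2) (univ ×ˢ Icc 0 T))
    (hb : ∀ R : ℝ, ∃ B : ℝ, ∀ X : H, ‖X‖ ≤ R → ∀ t ∈ Icc 0 T, ‖GW X t‖ ≤ B ∧ |Wt X t| ≤ B)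
    (hv : IntervalIntegrable v volume t T) :
    AbsolutelyContinuousOnInterval (fun s => W (state X t v s) s) t T ∧
      ∀ᵐ s, s ∈ uIcc t T → HasDerivAt (fun s => W (state X t v s) s)
        (Wt (state X t v s) s + ⟪GW (state X t v s) s, v s⟫) s := by
  have htT := ht.2
  have hsub : Icc t T ⊆ Icc 0 T := Icc_subset_Icc_left ht.1
  have hYc : ContinuousOn (state X t v) (Icc t T) := by
    have := intervalIntegral.continuousOn_primitive_interval' hv left_mem_uIcc
    rw [uIcc_of_le htT] at this
    exact continuousOn_const.add this
  have hvi : ∀ x ∈ Icc t T, ∀ y ∈ Icc t T, IntervalIntegrable v volume x y := fun x hx y hy =>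
    hv.mono_set (uIcc_subset_uIcc (by rwa [uIcc_of_le htT]) (by rwa [uIcc_of_le htT]))
  constructor
  · obtain ⟨R, hR⟩ := isCompact_Icc.exists_bound_of_continuousOn hYc
    obtain ⟨B, hB⟩ := hb R
    have hB0 : 0 ≤ B :=
      (norm_nonneg _).trans (hB _ (hR t (left_mem_Icc.2 htT)) t ht).1
    have hp : IntervalIntegrable (fun s => B * (‖v s‖ + 1)) volume t T :=
      (hv.norm.add intervalIntegrable_const).const_mul B
    refine (hp.absolutelyContinuousOnInterval_intervalIntegral left_mem_uIcc).of_dist_le ?_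
    rw [uIcc_of_le htT]
    have key : ∀ x ∈ Icc t T, ∀ y ∈ Icc t T, x ≤ y →
        dist (W (state X t v x) x) (W (state X t v y) y) ≤
          dist (∫ s in t..x, B * (‖v s‖ + 1)) (∫ s in t..y, B * (‖v s‖ + 1)) := by
      intro x hx y hy hxy
      have hpi : ∀ z ∈ Icc t T, IntervalIntegrable (fun s => B * (‖v s‖ + 1)) volume t z :=
        fun z hz => hp.mono_set (uIcc_subset_uIcc left_mem_uIcc (by rwa [uIcc_of_le htT]))
      have h1 : |W (state X t v y) y - W (state X t v x) y| ≤
          B * ‖state X t v y - state X t v x‖ :=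
        Convex.norm_image_sub_le_of_norm_hasFDerivWithin_le (𝕜 := ℝ)
          (f := fun X' => W X' y) (s := Metric.closedBall 0 R)
          (fun z _ => (hGW z y (hsub hy)).hasFDerivAt.hasFDerivWithinAt)
          (fun z hz => by
            simpa using (hB z (by simpa using hz) y (hsub hy)).1)
          (convex_closedBall _ _) (by simpa using hR x hx) (by simpa using hR y hy)
      have h2 : |W (state X t v x) y - W (state X t v x) x| ≤ B * ‖y - x‖ :=
        Convex.norm_image_sub_le_of_norm_hasDerivWithin_le (𝕜 := ℝ)
          (fun z hz => hWt (state X t v x) z hz)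
          (fun z hz => (hB _ (hR x hx) z hz).2)
          (convex_Icc _ _) (hsub hx) (hsub hy)
      have h3 : ‖state X t v y - state X t v x‖ ≤ ∫ s in x..y, ‖v s‖ := by
        have : state X t v y - state X t v x = ∫ s in x..y, v s := by
          simp only [state]
          rw [add_sub_add_left_eq_sub, intervalIntegral.integral_interval_sub_left]
          exacts [hvi t (left_mem_Icc.2 htT) y hy, hvi t (left_mem_Icc.2 htT) x hx]
        rw [this]
        exact intervalIntegral.norm_integral_le_integral_norm hxy
      have h4 : ∫ s in x..y, B * (‖v s‖ + 1) = B * ((∫ s in x..y, ‖v s‖) + (y - x)) := by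
        rw [intervalIntegral.integral_const_mul, intervalIntegral.integral_add
          (hvi x hx y hy).norm intervalIntegrable_const]
        simp
      rw [dist_comm, dist_comm (∫ s in t..x, _), Real.dist_eq, Real.dist_eq,
        intervalIntegral.integral_interval_sub_left (hpi y hy) (hpi x hx), h4]
      refine le_trans ?_ (le_abs_self _)
      have h5 : ‖y - x‖ = y - x := Real.norm_of_nonneg (by linarith)
      rw [h5] at h2
      have h6 := mul_le_mul_of_nonneg_left h3 hB0
      have h7 := abs_sub_le (W (state X t v y) y) (W (state X t v x) y) (W (state X t v x) x)
      linarith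
    intro x hx y hy
    rcases le_total x y with hxy | hxy
    · exact key x hx y hy hxy
    · rw [dist_comm, dist_comm (∫ s in t..x, _)]
      exact key y hy x hx hxy
  · have h₁ : ∀ᵐ s : ℝ, s ≠ t := by simp [ae_iff, measure_singleton]
    have h₂ : ∀ᵐ s : ℝ, s ≠ T := by simp [ae_iff, measure_singleton]
    filter_upwards [hv.ae_hasDerivAt_integral, h₁, h₂] with s hs hs1 hs2 hsT
    have hY : HasDerivAt (state X t v) (v s) s := (hs hsT t left_mem_uIcc).const_add X
    rw [uIcc_of_le htT] at hsT
    have hs0 : s ∈ Ioo 0 T :=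
      ⟨ht.1.trans_lt (lt_of_le_of_ne hsT.1 hs1.symm), lt_of_le_of_ne hsT.2 hs2⟩
    set Y := state X t v s
    have hnhds : univ ×ˢ Ioo 0 T ∈ 𝓝 (Y, s) := prod_mem_nhds univ_mem (Ioo_mem_nhds hs0.1 hs0.2)
    have hnhds' : univ ×ˢ Icc 0 T ∈ 𝓝 (Y, s) := prod_mem_nhds univ_mem (Icc_mem_nhds hs0.1 hs0.2)
    have hW := hasStrictFDerivAt_uncurry_coprod (𝕜 := ℝ) (u := (Y, s)) (f := W)
      (f₁ := fun x τ => InnerProductSpace.toDual ℝ H (GW x τ))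
      (f₂ := fun x τ => ContinuousLinearMap.toSpanSingleton ℝ (Wt x τ))
      (by
        filter_upwards [hnhds'] with p hp
        exact (hGW p.1 p.2 hp.2).hasFDerivAt)
      (by
        filter_upwards [hnhds] with p hp
        exact ((hWt p.1 p.2 (Ioo_subset_Icc_self hp.2)).hasDerivAt
          (Icc_mem_nhds hp.2.1 hp.2.2)).hasFDerivAt)
      ((InnerProductSpace.toDual ℝ H).continuous.continuousAt.comp
        (hGWc.continuousAt hnhds'))
      ((ContinuousLinearMap.toSpanSingletonCLE (𝕜 := ℝ)
        (E := ℝ)).continuous.continuousAt.comp (hWtc.continuousAt hnhds'))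
    refine (hW.hasFDerivAt.comp_hasDerivAt (f := fun τ => (state X t v τ, τ)) s
      (hY.prodMk (hasDerivAt_id s))).congr_deriv ?_
    simp [Function.HasUncurry.uncurry, add_comm]

/-- verification theorem and uniqueness for the HJB equation: any `C¹`
solution `W` of the HJB equation satisfying the stated growth and Lipschitz bounds lies
below the cost of every control, the feedback ODE has a unique solution whose associated
feedback control attains `W`, and hence `W` coincides with the value function. -/
theorem statement14
    (F FT : H → ℝ) (DF DFT : H → H) (c T lam : ℝ)
    (hF : ∀ X, HasGradientAt F (DF X) X) (hFT : ∀ X, HasGradientAt FT (DFT X) X)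
    (hDF : ∀ X₁ X₂ : H, ‖DF X₁ - DF X₂‖ ≤ c * ‖X₁ - X₂‖)
    (hDFT : ∀ X₁ X₂ : H, ‖DFT X₁ - DFT X₂‖ ≤ c * ‖X₁ - X₂‖)
    (hDF0 : ‖DF 0‖ ≤ c) (hDFT0 : ‖DFT 0‖ ≤ c)
    (hT : 0 < T) (hlam : 0 < lam)
    (hlc : c * T * (1 + T) < lam)
    (W : H → ℝ → ℝ) (GW : H → ℝ → H) (Wt : H → ℝ → ℝ) (C : ℝ)
    (hGW : ∀ X : H, ∀ t ∈ Icc 0 T, HasGradientAt (fun X' => W X' t) (GW X t) X)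
    (hWt : ∀ X : H, ∀ t ∈ Icc 0 T,
      HasDerivWithinAt (fun τ => W X τ) (Wt X t) (Icc 0 T) t)
    (hWb : ∀ X : H, ∀ t ∈ Icc 0 T, |W X t| ≤ C * (1 + ‖X‖ ^ 2))
    (hGWb : ∀ X : H, ∀ t ∈ Icc 0 T, ‖GW X t‖ ≤ C * (1 + ‖X‖))
    (hWtb : ∀ X : H, ∀ t ∈ Icc 0 T, |Wt X t| ≤ C * (1 + ‖X‖ ^ 2))
    (hGWlip : ∀ X₁ X₂ : H, ∀ t₁ ∈ Icc 0 T, ∀ t₂ ∈ Icc 0 T,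
      ‖GW X₁ t₁ - GW X₂ t₂‖ ≤ C * ‖X₁ - X₂‖ + C * |t₁ - t₂| * (1 + ‖X₁‖ + ‖X₂‖))
    (hHJB : ∀ X : H, ∀ t ∈ Icc 0 T, Wt X t - 1 / (2 * lam) * ‖GW X t‖ ^ 2 + F X = 0)
    (hWT : ∀ X : H, W X T = FT X) :
    ∀ X : H, ∀ t ∈ Icc 0 T,
      (∀ v : ℝ → H, Admissible t T v → W X t ≤ cost F FT lam X t T v) ∧
      (∃ Xh : ℝ → H,
        (ContinuousOn Xh (Icc t T) ∧ Xh t = X ∧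
          ∀ s ∈ Icc t T, HasDerivWithinAt Xh (-(1 / lam) • GW (Xh s) s) (Icc t T) s) ∧
        (∀ Xh' : ℝ → H, ContinuousOn Xh' (Icc t T) → Xh' t = X →
          (∀ s ∈ Icc t T, HasDerivWithinAt Xh' (-(1 / lam) • GW (Xh' s) s) (Icc t T) s) →
          ∀ s ∈ Icc t T, Xh' s = Xh s) ∧
        W X t = cost F FT lam X t T (fun s => -(1 / lam) • GW (Xh s) s)) ∧
      W X t = valueFn F FT lam T X t := by
  intro X t ht
  have htT := ht.2
  have hC : 0 ≤ C := by
    have := (abs_nonneg _).trans (hWb 0 t ht)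
    simpa using this
  have hFc : Continuous F := continuous_iff_continuousAt.2 fun x => (hF x).continuousAt
  have hGWc : ContinuousOn (fun p : H × ℝ => GW p.1 p.2) (univ ×ˢ Icc 0 T) := by
    intro p hp
    refine tendsto_iff_norm_sub_tendsto_zero.2 (squeeze_zero' (Eventually.of_forall fun _ =>
      norm_nonneg _) ?_ ?_ (g := fun q : H × ℝ =>
        C * ‖q.1 - p.1‖ + C * |q.2 - p.2| * (1 + ‖q.1‖ + ‖p.1‖)))
    · filter_upwards [self_mem_nhdsWithin] with q hq
      exact hGWlip q.1 p.1 q.2 hq.2 p.2 hp.2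
    · refine (Continuous.tendsto' ?_ p 0 (by simp)).mono_left nhdsWithin_le_nhds
      fun_prop
  have hWt_eq : ∀ x : H, ∀ s ∈ Icc 0 T, Wt x s = 1 / (2 * lam) * ‖GW x s‖ ^ 2 - F x :=
    fun x s hs => by linarith [hHJB x s hs]
  have hWtc : ContinuousOn (fun p : H × ℝ => Wt p.1 p.2) (univ ×ˢ Icc 0 T) :=
    ((continuousOn_const.mul (hGWc.norm.pow 2)).sub
      (hFc.comp continuous_fst).continuousOn).congr fun p hp => hWt_eq p.1 p.2 hp.2
  have hb : ∀ R : ℝ, ∃ B : ℝ, ∀ X : H, ‖X‖ ≤ R → ∀ t ∈ Icc 0 T, ‖GW X t‖ ≤ B ∧ |Wt X t| ≤ B := by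
    intro R
    refine ⟨max (C * (1 + R)) (C * (1 + R ^ 2)), fun x hx s hs => ⟨?_, ?_⟩⟩
    · exact ((hGWb x s hs).trans (by gcongr)).trans (le_max_left _ _)
    · exact ((hWtb x s hs).trans (by gcongr)).trans (le_max_right _ _)
  have hsub : Icc t T ⊆ Icc 0 T := Icc_subset_Icc_left ht.1
  have hst : ∀ v : ℝ → H, state X t v t = X := fun v => by simp [state]
  -- integrability of the running cost
  have hFi : ∀ v : ℝ → H, IntervalIntegrable v volume t T →
      IntervalIntegrable (fun s => F (state X t v s)) volume t T := fun v hv =>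
    (hFc.comp_continuousOn (continuousOn_const.add
      (intervalIntegral.continuousOn_primitive_interval' hv left_mem_uIcc))).intervalIntegrable
  have hFni : ∀ v : ℝ → H, IntervalIntegrable v volume t T →
      IntervalIntegrable (fun s => -F (state X t v s)) volume t T := fun v hv => (hFi v hv).neg
  have hcost : ∀ v : ℝ → H, Admissible t T v →
      cost F FT lam X t T v = FT (state X t v T) -
        ∫ s in t..T, (-F (state X t v s) - lam / 2 * ‖v s‖ ^ 2) := by
    intro v hv
    rw [intervalIntegral.integral_sub (hFni v hv.1) (hv.2.const_mul _),
      intervalIntegral.integral_neg, intervalIntegral.integral_const_mul, cost]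
    ring
  have hle : ∀ v : ℝ → H, Admissible t T v → W X t ≤ cost F FT lam X t T v := by
    intro v hv
    obtain ⟨hac, hder⟩ :=
      absolutelyContinuousOnInterval_comp_state (X := X) ht hGW hWt hGWc hWtc hb hv.1
    have hftc := hac.integral_deriv_eq_sub
    rw [hst, hWT] at hftc
    rw [hcost v hv]
    have := intervalIntegral.integral_mono_ae_restrict htT
      ((hFni v hv.1).sub (hv.2.const_mul (lam / 2))) hac.intervalIntegrable_deriv ?_
    · linarith
    · rw [EventuallyLE, ae_restrict_iff' measurableSet_Icc]
      filter_upwards [hder] with s hs hsT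
      rw [(hs (by rwa [uIcc_of_le htT])).deriv, hWt_eq _ s (hsub hsT)]
      set p := GW (state X t v s) s
      have h1 : 0 ≤ 1 / (2 * lam) * ‖p + lam • v s‖ ^ 2 := by positivity
      have h2 : 1 / (2 * lam) * ‖p + lam • v s‖ ^ 2 =
          1 / (2 * lam) * ‖p‖ ^ 2 + ⟪p, v s⟫ + lam / 2 * ‖v s‖ ^ 2 := by
        rw [norm_add_sq_real, inner_smul_right, norm_smul, Real.norm_of_nonneg hlam.le]
        field_simp
      linarith
  have hlip : ∀ s ∈ Icc t T, LipschitzWith (Real.toNNReal (1 / lam * C))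
      fun x => -(1 / lam) • GW x s := by
    intro s hs
    refine LipschitzWith.of_dist_le_mul fun x y => ?_
    rw [dist_eq_norm, dist_eq_norm, ← smul_sub, norm_smul, norm_neg,
      Real.norm_of_nonneg (by positivity), Real.coe_toNNReal _ (by positivity), mul_assoc]
    gcongr
    simpa using hGWlip x y s (hsub hs) s (hsub hs)
  obtain ⟨Xh, hXt, hXd⟩ := exists_forall_hasDerivWithinAt_of_lipschitzWith htT
    (f := fun s x => -(1 / lam) • GW x s)
    ((hGWc.comp continuous_swap.continuousOn fun p hp => ⟨mem_univ _, hsub hp.1⟩).const_smul _)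
    hlip X
  have hXc : ContinuousOn Xh (Icc t T) := fun s hs => (hXd s hs).continuousWithinAt
  set vh : ℝ → H := fun s => -(1 / lam) • GW (Xh s) s with hvh
  have hvc : ContinuousOn vh (Icc t T) :=
    (hGWc.comp (hXc.prodMk continuousOn_id) fun s hs => ⟨mem_univ _, hsub hs⟩).const_smul _
  have hva : Admissible t T vh := by
    rw [← uIcc_of_le htT] at hvc
    exact ⟨hvc.intervalIntegrable, (hvc.norm.pow 2).intervalIntegrable⟩
  have hstate : ∀ s ∈ Icc t T, state X t vh s = Xh s := by
    intro s hs
    have hss : Icc t s ⊆ Icc t T := Icc_subset_Icc_right hs.2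
    rw [state, intervalIntegral.integral_eq_sub_of_hasDerivAt_of_le hs.1 (hXc.mono hss)
      (fun r hr => (hXd r (hss (Ioo_subset_Icc_self hr))).hasDerivAt
        (Icc_mem_nhds hr.1 (hr.2.trans_le hs.2)))
      (by
        rw [← uIcc_of_le hs.1] at hss
        exact (hvc.mono hss).intervalIntegrable), hXt]
    abel
  have heq : W X t = cost F FT lam X t T vh := by
    obtain ⟨hac, hder⟩ :=
      absolutelyContinuousOnInterval_comp_state (X := X) ht hGW hWt hGWc hWtc hb hva.1
    have hftc := hac.integral_deriv_eq_sub
    rw [hst, hWT] at hftc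
    rw [hcost vh hva]
    have : ∫ s in t..T, (-F (state X t vh s) - lam / 2 * ‖vh s‖ ^ 2) =
        ∫ s in t..T, deriv (fun s => W (state X t vh s) s) s := by
      refine intervalIntegral.integral_congr_ae ?_
      filter_upwards [hder] with s hs hsT
      have hsT' := uIoc_subset_uIcc hsT
      rw [(hs hsT').deriv]
      rw [uIcc_of_le htT] at hsT'
      rw [hWt_eq _ s (hsub hsT'), hstate s hsT', hvh]
      simp only [inner_smul_right, norm_smul, norm_neg, real_inner_self_eq_norm_sq,
        Real.norm_of_nonneg (one_div_nonneg.2 hlam.le)]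
      field_simp
      ring
    linarith
  refine ⟨hle, ⟨Xh, ⟨hXc, hXt, hXd⟩, ?_, heq⟩, ?_⟩
  · intro Y hYc hYt hYd
    have hnhds : ∀ s ∈ Ico t T, Icc t T ∈ 𝓝[≥] s := fun s hs =>
      mem_of_superset (Icc_mem_nhdsGE hs.2) (Icc_subset_Icc_left hs.1)
    exact ODE_solution_unique_of_mem_Icc_right (s := fun _ => univ)
      (v := fun s x => -(1 / lam) • GW x s)
      (fun s hs => (hlip s (Ico_subset_Icc_self hs)).lipschitzOnWith) hYc
      (fun s hs => (hYd s (Ico_subset_Icc_self hs)).mono_of_mem_nhdsWithin (hnhds s hs))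
      (fun _ _ => mem_univ _) hXc
      (fun s hs => (hXd s (Ico_subset_Icc_self hs)).mono_of_mem_nhdsWithin (hnhds s hs))
      (fun _ _ => mem_univ _) (hYt.trans hXt.symm)
  · refine (IsLeast.csInf_eq (s := (fun v => cost F FT lam X t T v) '' {v | Admissible t T v})
      ⟨⟨vh, hva, heq.symm⟩, ?_⟩).symm
    rintro _ ⟨v, hv, rfl⟩
    exact hle v hv
end
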